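/- Let t_n be the number of isomorphism classes of Δ-trees of order n. Then there exist real constants τ > 0 and x₀ with 0 < x₀ ≤ 1/2 such that t_n · n^{5/2} · x₀ⁿ → τ as n → ∞; that is, t_n is asymptotically equal to τ · x₀^{−n} / n^{5/2}. -/

import Mathlib

open Filter Topology MeasureTheory

namespace TreePaper

/-- The degree of a vertex `v` in a simple graph on `Fin n`. -/
noncomputable def degr {n : ℕ} (G : SimpleGraph (Fin n)) (v : Fin n) : ℕ :=
  Nat.card {u : Fin n // G.Adj v u}

/-- A `Δ`-tree of order `n`: a tree on `n` vertices with all degrees at most `Δ`. -/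
abbrev DTree (Δ n : ℕ) : Type :=
  {G : SimpleGraph (Fin n) // G.IsTree ∧ ∀ v, degr G v ≤ Δ}

instance treeSetoid (Δ n : ℕ) : Setoid (DTree Δ n) where
  r G H := Nonempty (G.1 ≃g H.1)
  iseqv :=
    ⟨fun G => ⟨SimpleGraph.Iso.refl⟩, fun ⟨e⟩ => ⟨e.symm⟩, fun ⟨e⟩ ⟨f⟩ => ⟨e.trans f⟩⟩

/-- Isomorphism classes of `Δ`-trees of order `n`. -/
abbrev TClass (Δ n : ℕ) : Type := Quotient (treeSetoid Δ n)

/-- The number of vertices of degree `j` in `G`. -/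
noncomputable def vcount {n : ℕ} (j : ℕ) (G : SimpleGraph (Fin n)) : ℕ :=
  Nat.card {v : Fin n // degr G v = j}

/-- The number of vertices of degree `j`, as a random variable on iso classes. -/
noncomputable def Xdeg (Δ n j : ℕ) (c : TClass Δ n) : ℕ :=
  vcount j (Quotient.out c).1

/-- Probability of an event under the uniform measure on iso classes of `Δ`-trees. -/
noncomputable def prob (Δ n : ℕ) (P : TClass Δ n → Prop) : ℝ :=
  (Nat.card {c : TClass Δ n // P c} : ℝ) / (Nat.card (TClass Δ n) : ℝ)

/-- Expectation under the uniform measure on iso classes of `Δ`-trees. -/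
noncomputable def mean (Δ n : ℕ) (f : TClass Δ n → ℝ) : ℝ :=
  (∑ᶠ c : TClass Δ n, f c) / (Nat.card (TClass Δ n) : ℝ)

/-- Variance under the uniform measure on iso classes of `Δ`-trees. -/
noncomputable def variance (Δ n : ℕ) (f : TClass Δ n → ℝ) : ℝ :=
  (∑ᶠ c : TClass Δ n, (f c - mean Δ n f) ^ 2) / (Nat.card (TClass Δ n) : ℝ)

/-- The standard normal distribution function. -/
noncomputable def stdNormalCDF (t : ℝ) : ℝ :=
  (Real.sqrt (2 * Real.pi))⁻¹ * ∫ s in Set.Iic t, Real.exp (-(s ^ 2) / 2)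



/-- `t_n`: the number of iso classes of `Δ`-trees of order `n`. -/
noncomputable def tTotal (Δ n : ℕ) : ℕ := Nat.card (TClass Δ n)

theorem ringChoose_eq_prod (a : ℝ) (n : ℕ) :
    Ring.choose (a + n - 1) n = (∏ j ∈ Finset.range n, (a + j)) / (n.factorial : ℝ) := by
  rw [Ring.choose_eq_smul, Polynomial.descPochhammer_smeval_eq_ascPochhammer,
    Polynomial.ascPochhammer_smeval_eq_eval, smul_eq_mul, inv_mul_eq_div]
  congr 1
  rw [show a + n - 1 - n + 1 = a by ring]
  induction n with
  | zero => simp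
  | succ n ih => rw [ascPochhammer_succ_eval, ih, Finset.prod_range_succ]

theorem tendsto_ringChoose_div_rpow (a : ℝ) (ha : 0 < a) :
    Tendsto (fun n : ℕ => Ring.choose (a + n - 1) n / (n : ℝ) ^ (a - 1)) atTop
      (𝓝 (1 / Real.Gamma a)) := by
  have h1 := Real.GammaSeq_tendsto_Gamma a
  have h2 : Tendsto (fun n : ℕ => (n : ℝ) / (n + a)) atTop (𝓝 1) :=
    tendsto_natCast_div_add_atTop a
  have h3 := h2.div h1 (Real.Gamma_pos_of_pos ha).ne'
  refine h3.congr' ?_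
  filter_upwards [eventually_gt_atTop 0] with n hn
  have hn' : (0 : ℝ) < n := by exact_mod_cast hn
  have hp : (0 : ℝ) < ∏ j ∈ Finset.range n, (a + j) := by
    apply Finset.prod_pos; intros; positivity
  rw [ringChoose_eq_prod, Pi.div_apply, Real.GammaSeq, Finset.prod_range_succ, Real.rpow_sub_one hn'.ne']
  have : (0 : ℝ) < (n : ℝ) ^ a := by positivity
  have : (0 : ℝ) < n.factorial := by positivity
  have : (0 : ℝ) < n + a := by positivity
  have : (0 : ℝ) < a + n := by positivity
  field_simp
  ring

theorem integral_rpow_neg_three_halves_le {δ : ℝ} (hδ : 0 < δ) {b : ℝ} (hb : 0 ≤ b) :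
    ∫ θ in (0 : ℝ)..b, (δ + θ) ^ (-(3 / 2) : ℝ) ≤ 2 * δ ^ (-(1 / 2) : ℝ) := by
  rw [intervalIntegral.integral_comp_add_left (fun x => x ^ (-(3 / 2) : ℝ)), integral_rpow]
  · have : 0 ≤ (δ + b) ^ (-(3 / 2) + 1 : ℝ) := by positivity
    rw [add_zero]
    norm_num at this ⊢
    linarith
  · right
    constructor
    · norm_num
    · rw [Set.uIcc_of_le (by linarith)]
      simp; intro h; linarith

theorem norm_one_sub_circleMap_ge {r θ : ℝ} (hr : 1 / 2 ≤ r) (hr1 : r < 1) (h0 : 0 ≤ θ)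
    (h1 : θ ≤ Real.pi) : (1 / 5) * ((1 - r) + θ) ≤ ‖1 - circleMap 0 r θ‖ := by
  have hpi := Real.pi_gt_three
  have hpi4 := Real.pi_lt_four
  have hs : θ / Real.pi ≤ Real.sin (θ / 2) := by
    have := Real.mul_le_sin (x := θ / 2) (by linarith) (by linarith)
    calc θ / Real.pi = 2 / Real.pi * (θ / 2) := by ring
      _ ≤ _ := this
  have hs' : θ / 4 ≤ Real.sin (θ / 2) := by
    refine le_trans ?_ hs
    gcongr
  have hsq : ‖1 - circleMap 0 r θ‖ ^ 2 = (1 - r) ^ 2 + 4 * r * Real.sin (θ / 2) ^ 2 := by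
    rw [← Complex.normSq_eq_norm_sq, Complex.normSq_apply]
    have hc : Real.cos θ = 1 - 2 * Real.sin (θ / 2) ^ 2 := by
      have := Real.cos_two_mul (θ / 2)
      rw [Real.cos_sq'] at this
      rw [show θ = 2 * (θ / 2) by ring, this]; ring_nf
    simp [circleMap, Complex.exp_re, Complex.exp_im]
    have := Real.sin_sq_add_cos_sq θ
    have h3 : Real.sin θ ^ 2 = 1 - Real.cos θ ^ 2 := by linarith
    ring_nf
    ring_nf at h3 hc
    rw [h3, hc]
    ring
  refine le_of_sq_le_sq ?_ (norm_nonneg _)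
  rw [hsq]
  have h4 : (θ / 4) ^ 2 ≤ Real.sin (θ / 2) ^ 2 := by gcongr
  nlinarith [sq_nonneg ((1 - r) - θ), mul_le_mul hr h4 (by positivity) (by linarith)]

theorem norm_coeff_le_integral {e : ℕ → ℂ} {g : ℂ → ℂ}
    (hg : ∀ z : ℂ, ‖z‖ < 1 → HasSum (fun n => e n * z ^ n) (g z)) {r : ℝ} (hr : 0 < r)
    (hr1 : r < 1) (n : ℕ) :
    ContinuousOn g (Metric.sphere 0 r) ∧
    ‖e n‖ * r ^ n ≤ (2 * Real.pi)⁻¹ * ∫ θ in (0 : ℝ)..2 * Real.pi, ‖g (circleMap 0 r θ)‖ := by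
  have hps : HasFPowerSeriesOnBall g (FormalMultilinearSeries.ofScalars ℂ e) 0 1 := by
    refine ⟨?_, by norm_num, ?_⟩
    · refine ENNReal.le_of_forall_nnreal_lt fun s hs => ?_
      apply FormalMultilinearSeries.le_radius_of_summable_norm
      have hs1 : (s : ℝ) < 1 := by exact_mod_cast hs
      have := (hg (s : ℝ) (by simpa using hs1)).summable.norm
      refine this.congr ?_
      intro n
      simp
    · intro y hy
      have hy1 : ‖y‖ < 1 := by
        rw [mem_eball_zero_iff, ← ofReal_norm, ENNReal.ofReal_lt_one] at hy
        exact hy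
      simpa [FormalMultilinearSeries.ofScalars_apply_eq, mul_comm] using hg y hy1
  have hd : DifferentiableOn ℂ g (Metric.ball 0 1) := by
    have := hps.differentiableOn
    rwa [← Metric.eball_ofReal, ENNReal.ofReal_one]
  have hsub : Metric.closedBall (0 : ℂ) r ⊆ Metric.ball 0 1 := Metric.closedBall_subset_ball hr1
  lift r to NNReal using hr.le
  have h2 := (hd.mono hsub).hasFPowerSeriesOnBall (by exact_mod_cast hr)
  refine ⟨(hd.continuousOn.mono (Metric.sphere_subset_closedBall.trans hsub)), ?_⟩
  have heq := HasFPowerSeriesAt.eq_formalMultilinearSeries h2.hasFPowerSeriesAt hps.hasFPowerSeriesAt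
  have h3 := norm_cauchyPowerSeries_le g 0 r n
  rw [heq, FormalMultilinearSeries.ofScalars_norm] at h3
  rw [abs_of_pos hr] at h3
  calc _ ≤ _ := mul_le_mul_of_nonneg_right h3 (by positivity)
    _ = _ := by
      rw [mul_assoc, ← mul_pow, inv_mul_cancel₀ hr.ne', one_pow, mul_one]

theorem norm_one_sub_circleMap_rpow_le {r θ : ℝ} (hr : 1 / 2 ≤ r) (hr1 : r < 1) (h0 : 0 ≤ θ)
    (h1 : θ ≤ 2 * Real.pi) : ‖1 - circleMap 0 r θ‖ ^ (-(3 / 2) : ℝ) ≤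
      (1 / 5) ^ (-(3 / 2) : ℝ) * (((1 - r) + θ) ^ (-(3 / 2) : ℝ) +
        ((1 - r) + (2 * Real.pi - θ)) ^ (-(3 / 2) : ℝ)) := by
  have hA : 0 < (1 - r) + θ := by linarith
  have hB : 0 < (1 - r) + (2 * Real.pi - θ) := by linarith
  rw [mul_add, ← Real.mul_rpow (by norm_num) hA.le, ← Real.mul_rpow (by norm_num) hB.le]
  rcases le_total θ Real.pi with h | h
  · have := norm_one_sub_circleMap_ge hr hr1 h0 h
    calc _ ≤ (1 / 5 * (1 - r + θ)) ^ (-(3 / 2) : ℝ) :=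
          Real.rpow_le_rpow_of_nonpos (by positivity) this (by norm_num)
      _ ≤ _ := le_add_of_nonneg_right (by positivity)
  · have := norm_one_sub_circleMap_ge hr hr1 (θ := 2 * Real.pi - θ) (by linarith) (by linarith)
    have hc : ‖1 - circleMap 0 r (2 * Real.pi - θ)‖ = ‖1 - circleMap 0 r θ‖ := by
      rw [← Complex.norm_conj]
      congr 1
      simp [circleMap, sub_mul, Complex.exp_sub, Complex.exp_two_pi_mul_I, ← Complex.exp_conj,
        Complex.exp_neg]
    rw [hc] at this
    calc _ ≤ (1 / 5 * (1 - r + (2 * Real.pi - θ))) ^ (-(3 / 2) : ℝ) :=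
          Real.rpow_le_rpow_of_nonpos (by positivity) this (by norm_num)
      _ ≤ _ := le_add_of_nonneg_left (by positivity)

theorem exists_norm_coeff_le : ∃ C : ℝ, 0 < C ∧ ∀ (e : ℕ → ℂ) (g : ℂ → ℂ) (ε M : ℝ), 0 ≤ ε → 0 ≤ M →
    (∀ z : ℂ, ‖z‖ < 1 → HasSum (fun n => e n * z ^ n) (g z)) →
    (∀ z : ℂ, ‖z‖ < 1 → ‖g z‖ ≤ ε * ‖1 - z‖ ^ (-(3 / 2) : ℝ) + M) →
    ∀ n : ℕ, 1 ≤ n → ‖e n‖ ≤ C * (ε * (n : ℝ) ^ (1 / 2 : ℝ) + M) := by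
  set κ : ℝ := (1 / 5) ^ (-(3 / 2) : ℝ) with hκ
  have hκ0 : 0 < κ := by positivity
  refine ⟨2 * (κ * 4 * 2 ^ (1 / 2 : ℝ) + 1), by positivity, ?_⟩
  intro e g ε M hε hM hg hb n hn
  have hn' : (1 : ℝ) ≤ n := by exact_mod_cast hn
  set δ : ℝ := 1 / (2 * n) with hδ
  have hδ0 : 0 < δ := by positivity
  have hδ1 : δ ≤ 1 / 2 := by
    rw [hδ]; apply one_div_le_one_div_of_le <;> linarith
  have hpi := Real.pi_gt_three
  obtain ⟨hc, h1⟩ := norm_coeff_le_integral hg (r := 1 - δ) (by linarith) (by linarith) n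
  have hI : ∫ θ in (0 : ℝ)..2 * Real.pi, ‖g (circleMap 0 (1 - δ) θ)‖ ≤
      ∫ θ in (0 : ℝ)..2 * Real.pi, (ε * (κ * ((δ + θ) ^ (-(3 / 2) : ℝ) +
        (δ + (2 * Real.pi - θ)) ^ (-(3 / 2) : ℝ))) + M) := by
    have hcont : ContinuousOn (fun θ : ℝ => (δ + θ) ^ (-(3 / 2) : ℝ)) (Set.Icc 0 (2 * Real.pi)) := by
      apply ContinuousOn.rpow_const (by fun_prop)
      intro x hx; left; have := hx.1; linarith
    have hcont' : ContinuousOn (fun θ : ℝ => (δ + (2 * Real.pi - θ)) ^ (-(3 / 2) : ℝ))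
        (Set.Icc 0 (2 * Real.pi)) := by
      apply ContinuousOn.rpow_const (by fun_prop)
      intro x hx; left; have := hx.2; linarith
    apply intervalIntegral.integral_mono_on (by positivity)
    · apply Continuous.intervalIntegrable
      apply Continuous.norm
      apply hc.comp_continuous (continuous_circleMap 0 _)
      intro x
      apply circleMap_mem_sphere
      linarith
    · apply ContinuousOn.intervalIntegrable
      rw [Set.uIcc_of_le (by positivity)]
      fun_prop
    · intro θ hθ
      have hz : ‖circleMap 0 (1 - δ) θ‖ < 1 := by
        rw [norm_circleMap_zero, abs_of_pos] <;> linarith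
      refine (hb _ hz).trans ?_
      have := norm_one_sub_circleMap_rpow_le (r := 1 - δ) (by linarith) (by linarith) hθ.1 hθ.2
      rw [sub_sub_cancel] at this
      gcongr
  have hI2 : ∫ θ in (0 : ℝ)..2 * Real.pi, (ε * (κ * ((δ + θ) ^ (-(3 / 2) : ℝ) +
        (δ + (2 * Real.pi - θ)) ^ (-(3 / 2) : ℝ))) + M) ≤
        ε * (κ * (4 * δ ^ (-(1 / 2) : ℝ))) + M * (2 * Real.pi) := by
    have hcont : IntervalIntegrable (fun θ : ℝ => (δ + θ) ^ (-(3 / 2) : ℝ)) volume 0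
        (2 * Real.pi) := by
      apply ContinuousOn.intervalIntegrable
      rw [Set.uIcc_of_le (by positivity)]
      apply ContinuousOn.rpow_const (by fun_prop)
      intro x hx; left; have := hx.1; linarith
    have hcont' : IntervalIntegrable (fun θ : ℝ => (δ + (2 * Real.pi - θ)) ^ (-(3 / 2) : ℝ)) volume
        0 (2 * Real.pi) := by
      apply ContinuousOn.intervalIntegrable
      rw [Set.uIcc_of_le (by positivity)]
      apply ContinuousOn.rpow_const (by fun_prop)
      intro x hx; left; have := hx.2; linarith
    rw [intervalIntegral.integral_add (((hcont.add hcont').const_mul κ).const_mul ε) (by simp),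
      intervalIntegral.integral_const_mul, intervalIntegral.integral_const_mul,
      intervalIntegral.integral_add hcont hcont',
      intervalIntegral.integral_comp_sub_left (fun θ => (δ + θ) ^ (-(3 / 2) : ℝ))]
    have := integral_rpow_neg_three_halves_le hδ0 (b := 2 * Real.pi) (by positivity)
    simp only [sub_self, sub_zero, intervalIntegral.integral_const, smul_eq_mul]
    have h2 : κ * ((∫ θ in (0 : ℝ)..2 * Real.pi, (δ + θ) ^ (-(3 / 2) : ℝ)) +
      ∫ θ in (0 : ℝ)..2 * Real.pi, (δ + θ) ^ (-(3 / 2) : ℝ)) ≤ κ * (4 * δ ^ (-(1 / 2) : ℝ)) := by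
      gcongr; linarith
    have := mul_le_mul_of_nonneg_left h2 hε
    linarith
  have hδp : δ ^ (-(1 / 2) : ℝ) = 2 ^ (1 / 2 : ℝ) * (n : ℝ) ^ (1 / 2 : ℝ) := by
    rw [hδ, one_div, Real.inv_rpow (by positivity), ← Real.rpow_neg (by positivity), neg_neg,
      Real.mul_rpow (by norm_num) (by positivity)]
  have hr : 1 / 2 ≤ (1 - δ) ^ n := by
    have := one_add_mul_le_pow (a := -δ) (by linarith) n
    have h3 : (n : ℝ) * -δ = -(1 / 2) := by rw [hδ]; field_simp
    rw [h3] at this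
    rw [sub_eq_add_neg]
    linarith
  have h4 : ‖e n‖ * (1 / 2) ≤ ε * (κ * (4 * δ ^ (-(1 / 2) : ℝ))) + M := by
    calc ‖e n‖ * (1 / 2) ≤ ‖e n‖ * (1 - δ) ^ n := by gcongr
      _ ≤ _ := h1
      _ ≤ (2 * Real.pi)⁻¹ * (ε * (κ * (4 * δ ^ (-(1 / 2) : ℝ))) + M * (2 * Real.pi)) := by
          gcongr; exact hI.trans hI2
      _ = (2 * Real.pi)⁻¹ * (ε * (κ * (4 * δ ^ (-(1 / 2) : ℝ)))) + M := by
          field_simp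
      _ ≤ _ := by
          refine add_le_add ?_ le_rfl
          apply mul_le_of_le_one_left (by positivity)
          apply inv_le_one_of_one_le₀; linarith
  rw [hδp] at h4
  set u := (n : ℝ) ^ (1 / 2 : ℝ)
  set w := (2 : ℝ) ^ (1 / 2 : ℝ)
  have hu : 0 < u := by positivity
  have hw : 0 < w := by positivity
  have : 0 ≤ ε * u := by positivity
  have : 0 ≤ κ * 4 * w * M := by positivity
  nlinarith

theorem tendsto_coeff_of_singularity {c : ℕ → ℂ} {G : ℂ → ℂ} {D : ℂ}
    (hG : ∀ z : ℂ, ‖z‖ < 1 → HasSum (fun n => c n * z ^ n) (G z))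
    (hlim : Tendsto (fun z => G z * (1 - z) ^ (3 / 2 : ℂ)) (𝓝[Metric.ball 0 1] 1) (𝓝 D))
    (hbd : ∀ δ > 0, ∃ M, ∀ z : ℂ, ‖z‖ < 1 → δ ≤ ‖1 - z‖ → ‖G z‖ ≤ M) :
    Tendsto (fun n : ℕ => c n / ((n : ℝ) ^ (1 / 2 : ℝ) : ℝ)) atTop
      (𝓝 (D / (Real.Gamma (3 / 2) : ℝ))) := by
  obtain ⟨C, hC, hcoef⟩ := exists_norm_coeff_le
  set b : ℕ → ℂ := fun n => Ring.choose ((3 / 2 : ℂ) + n - 1) n with hb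
  have hS : ∀ z : ℂ, ‖z‖ < 1 → HasSum (fun n => b n * z ^ n) (1 / (1 - z) ^ (3 / 2 : ℂ)) := by
    intro z hz
    have := (Complex.one_div_one_sub_cpow_hasFPowerSeriesOnBall_zero (3 / 2)).hasSum (y := z)
      (by rw [mem_eball_zero_iff, ← ofReal_norm, ENNReal.ofReal_lt_one]; exact hz)
    simpa [FormalMultilinearSeries.ofScalars_apply_eq, mul_comm, hb] using this
  have hbl : Tendsto (fun n : ℕ => D * (b n / ((n : ℝ) ^ (1 / 2 : ℝ) : ℝ))) atTop
      (𝓝 (D / (Real.Gamma (3 / 2) : ℝ))) := by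
    have h := tendsto_ringChoose_div_rpow (3 / 2) (by norm_num)
    have h' := (Complex.continuous_ofReal.tendsto _).comp h
    have hD := h'.const_mul D
    have e1 : (3 / 2 - 1 : ℝ) = 1 / 2 := by norm_num
    rw [e1] at hD
    convert hD using 2
    · rename_i n
      simp only [hb, Function.comp_apply, Complex.ofReal_div, Complex.ofReal_choose]
      push_cast; rfl
    · push_cast; ring
  have hdiff : Tendsto (fun n : ℕ => (c n - D * b n) / ((n : ℝ) ^ (1 / 2 : ℝ) : ℝ)) atTop
      (𝓝 0) := by
    rw [Metric.tendsto_atTop]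
    intro η hη
    set ε := η / (4 * C)
    have hε : 0 < ε := by positivity
    have hnear := (Metric.tendsto_nhdsWithin_nhds.1 hlim) ε hε
    obtain ⟨δ, hδ, hnear⟩ := hnear
    obtain ⟨M, hM⟩ := hbd δ hδ
    have hbound : ∀ z : ℂ, ‖z‖ < 1 → ‖G z - D * (1 / (1 - z) ^ (3 / 2 : ℂ))‖ ≤
        ε * ‖1 - z‖ ^ (-(3 / 2) : ℝ) + (|M| + ‖D‖ * δ ^ (-(3 / 2) : ℝ)) := by
      intro z hz
      have hz1 : 1 - z ≠ 0 := by
        intro h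
        rw [sub_eq_zero] at h
        rw [← h] at hz; simp at hz
      have hn : ‖(1 - z) ^ (3 / 2 : ℂ)‖ = ‖1 - z‖ ^ (3 / 2 : ℝ) := by
        have := Complex.norm_cpow_real (1 - z) (3 / 2)
        push_cast at this
        exact this
      have hpos : 0 < ‖1 - z‖ := norm_pos_iff.2 hz1
      have hne : (1 - z) ^ (3 / 2 : ℂ) ≠ 0 := by
        rw [← norm_pos_iff, hn]; positivity
      rcases lt_or_ge ‖1 - z‖ δ with h | h
      · have h5 := hnear (x := z) (by simpa using hz) (by rwa [dist_comm, dist_eq_norm])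
        rw [dist_eq_norm] at h5
        have : G z - D * (1 / (1 - z) ^ (3 / 2 : ℂ)) =
            (G z * (1 - z) ^ (3 / 2 : ℂ) - D) / (1 - z) ^ (3 / 2 : ℂ) := by
          field_simp
        rw [this, norm_div, hn, Real.rpow_neg hpos.le, ← div_eq_mul_inv]
        have : 0 ≤ |M| + ‖D‖ * δ ^ (-(3 / 2) : ℝ) := by positivity
        have : ‖G z * (1 - z) ^ (3 / 2 : ℂ) - D‖ / ‖1 - z‖ ^ (3 / 2 : ℝ) ≤
          ε / ‖1 - z‖ ^ (3 / 2 : ℝ) := by gcongr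
        linarith
      · have h6 := (hM z hz h).trans (le_abs_self M)
        have h7 : ‖D * (1 / (1 - z) ^ (3 / 2 : ℂ))‖ ≤ ‖D‖ * δ ^ (-(3 / 2) : ℝ) := by
          rw [norm_mul, norm_div, hn, norm_one, one_div, ← Real.rpow_neg hpos.le]
          gcongr ?_ * ?_
          exact Real.rpow_le_rpow_of_nonpos hδ h (by norm_num)
        have : 0 ≤ ε * ‖1 - z‖ ^ (-(3 / 2) : ℝ) := by positivity
        have := norm_sub_le (G z) (D * (1 / (1 - z) ^ (3 / 2 : ℂ)))
        linarith
    set M' := |M| + ‖D‖ * δ ^ (-(3 / 2) : ℝ)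
    have hM' : 0 ≤ M' := by positivity
    have hco := hcoef (fun n => c n - D * b n) (fun z => G z - D * (1 / (1 - z) ^ (3 / 2 : ℂ))) ε M'
      hε.le hM' (fun z hz => by
        have := (hG z hz).sub ((hS z hz).mul_left D)
        convert! this using 2 with n
        ring) hbound
    have hlarge : ∀ᶠ n : ℕ in atTop, 4 * C * M' / η < (n : ℝ) ^ (1 / 2 : ℝ) :=
      ((tendsto_rpow_atTop (by norm_num)).comp tendsto_natCast_atTop_atTop).eventually_gt_atTop _
    obtain ⟨N, hN⟩ := eventually_atTop.1 (hlarge.and (eventually_ge_atTop 1))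
    refine ⟨N, fun n hn => ?_⟩
    obtain ⟨h1, h2⟩ := hN n hn
    have hn' : (1 : ℝ) ≤ n := by exact_mod_cast h2
    have hu : 0 < (n : ℝ) ^ (1 / 2 : ℝ) := by positivity
    rw [dist_zero_right, norm_div, Complex.norm_real, Real.norm_of_nonneg hu.le, div_lt_iff₀ hu]
    refine (hco n h2).trans_lt ?_
    rw [div_lt_iff₀ hη] at h1
    have : C * ε = η / 4 := by simp only [ε]; field_simp
    rw [mul_add, ← mul_assoc, this]
    nlinarith
  have := hdiff.add hbl
  rw [zero_add] at this
  refine this.congr fun n => ?_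
  ring

open PowerSeries in
/-- The power series that converge absolutely at radius `r`. -/
def absSummable (r : ℝ) : Subalgebra ℝ ℝ⟦X⟧ where
  carrier := {f | Summable fun n => ‖coeff n f * r ^ n‖}
  mul_mem' {f g} hf hg := by
    have := summable_norm_sum_mul_antidiagonal_of_summable_norm hf hg
    refine this.congr fun n => ?_
    rw [coeff_mul, Finset.sum_mul]
    congr 1
    refine Finset.sum_congr rfl fun x hx => ?_
    rw [← Finset.HasAntidiagonal.mem_antidiagonal.mp hx, pow_add]
    ring
  add_mem' {f g} hf hg := by
    refine Summable.of_nonneg_of_le (fun _ => norm_nonneg _) (fun n => ?_) (hf.add hg)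
    rw [map_add, add_mul]
    exact norm_add_le _ _
  algebraMap_mem' c := by
    refine summable_of_ne_finset_zero (s := {0}) fun n hn => ?_
    rw [Finset.mem_singleton] at hn
    simp [coeff_C, hn]

/-- The value at `z` of a real power series. -/
noncomputable def eval {𝕜 : Type*} [RCLike 𝕜] (z : 𝕜) (f : PowerSeries ℝ) : 𝕜 :=
  ∑' n, ((PowerSeries.coeff n f : ℝ) : 𝕜) * z ^ n

/-- The Euler operator `X · d/dX`. -/
noncomputable def euler : Derivation ℝ (PowerSeries ℝ) (PowerSeries ℝ) :=
  (PowerSeries.X : PowerSeries ℝ) • PowerSeries.derivative ℝ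

section
open PowerSeries
variable {𝕜 : Type*} [RCLike 𝕜] {r s : ℝ} {f g : ℝ⟦X⟧} {z : 𝕜}

theorem coeff_euler (f : ℝ⟦X⟧) (n : ℕ) : coeff n (euler f) = n * coeff n f := by
  rw [euler, Derivation.smul_apply, smul_eq_mul]
  cases n with
  | zero => simp
  | succ n => rw [coeff_succ_X_mul, coeff_derivative]; push_cast; ring

theorem mem_absSummable : f ∈ absSummable r ↔ Summable fun n => ‖coeff n f * r ^ n‖ := Iff.rfl

theorem summable_norm_coeff_mul_pow (hf : f ∈ absSummable r) (hz : ‖z‖ ≤ r) :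
    Summable fun n => ‖((coeff n f : ℝ) : 𝕜) * z ^ n‖ := by
  refine Summable.of_nonneg_of_le (fun _ => norm_nonneg _) (fun n => ?_) hf
  rw [norm_mul, norm_mul, norm_pow, norm_pow, RCLike.norm_ofReal]
  gcongr
  · exact le_rfl
  · exact hz.trans (le_abs_self r)

theorem absSummable_mono (hs : 0 ≤ s) (hsr : s ≤ r) : absSummable r ≤ absSummable s := fun f hf => by
  simpa [mem_absSummable] using
    summable_norm_coeff_mul_pow (𝕜 := ℝ) (z := s) hf (by rwa [Real.norm_of_nonneg hs])

theorem hasSum_eval (hf : f ∈ absSummable r) (hz : ‖z‖ ≤ r) :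
    HasSum (fun n => ((coeff n f : ℝ) : 𝕜) * z ^ n) (eval z f) :=
  (summable_norm_coeff_mul_pow hf hz).of_norm.hasSum

theorem eval_add (hf : f ∈ absSummable r) (hg : g ∈ absSummable r) (hz : ‖z‖ ≤ r) :
    eval z (f + g) = eval z f + eval z g := by
  rw [eval, eval, eval, ← (hasSum_eval hf hz).summable.tsum_add (hasSum_eval hg hz).summable]
  simp [add_mul]

theorem eval_neg : eval z (-f) = - eval z f := by
  simp [eval, tsum_neg]

theorem eval_sub (hf : f ∈ absSummable r) (hg : g ∈ absSummable r) (hz : ‖z‖ ≤ r) :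
    eval z (f - g) = eval z f - eval z g := by
  rw [sub_eq_add_neg, eval_add hf (neg_mem hg) hz, eval_neg, sub_eq_add_neg]

theorem eval_mul (hf : f ∈ absSummable r) (hg : g ∈ absSummable r) (hz : ‖z‖ ≤ r) :
    eval z (f * g) = eval z f * eval z g := by
  have h1 := summable_norm_coeff_mul_pow hf hz
  have h2 := summable_norm_coeff_mul_pow hg hz
  refine Eq.trans ?_ (tsum_mul_tsum_eq_tsum_sum_antidiagonal_of_summable_norm h1 h2).symm
  refine tsum_congr fun n => ?_
  rw [coeff_mul, RCLike.ofReal_sum, Finset.sum_mul]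
  refine Finset.sum_congr rfl fun x hx => ?_
  have hx : x.1 + x.2 = n := by simpa using hx
  subst hx
  rw [pow_add, RCLike.ofReal_mul]
  ring

theorem eval_C (c : ℝ) : eval z (C c) = (c : 𝕜) := by
  rw [eval, tsum_eq_single 0]
  · simp
  · intro n hn; simp [coeff_C, hn]

theorem eval_one : eval z 1 = 1 := by simpa using eval_C (z := z) 1

theorem eval_zero : eval z 0 = 0 := by simp [eval]

theorem X_mem_absSummable : X ∈ absSummable r := by
  refine summable_of_ne_finset_zero (s := {1}) fun n hn => ?_
  rw [Finset.mem_singleton] at hn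
  simp [coeff_X, hn]

theorem C_mem_absSummable (c : ℝ) : C c ∈ absSummable r := (absSummable r).algebraMap_mem c

theorem eval_X : eval z X = z := by
  rw [eval, tsum_eq_single 1]
  · simp
  · intro n hn; simp [coeff_X, hn]

theorem eval_pow (hf : f ∈ absSummable r) (hz : ‖z‖ ≤ r) (n : ℕ) :
    eval z (f ^ n) = eval z f ^ n := by
  induction n with
  | zero => simp [eval_one]
  | succ n ih => rw [pow_succ, eval_mul (pow_mem hf n) hf hz, ih, pow_succ]

theorem eval_sum {ι : Type*} (u : Finset ι) {f : ι → ℝ⟦X⟧} (hf : ∀ i ∈ u, f i ∈ absSummable r)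
    (hz : ‖z‖ ≤ r) : eval z (∑ i ∈ u, f i) = ∑ i ∈ u, eval z (f i) := by
  classical
  induction u using Finset.induction_on with
  | empty => simp [eval_zero]
  | insert a u ha ih =>
    rw [Finset.sum_insert ha, Finset.sum_insert ha, eval_add (hf _ (by simp))
      (sum_mem fun i hi => hf i (by simp [hi])) hz, ih fun i hi => hf i (by simp [hi])]

theorem eval_ofReal (x : ℝ) : eval (x : ℂ) f = ((eval x f : ℝ) : ℂ) := by
  simp [eval, Complex.ofReal_tsum]

theorem eval_nonneg (hf : ∀ n, 0 ≤ coeff n f) {x : ℝ} (hx : 0 ≤ x) : 0 ≤ eval x f :=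
  tsum_nonneg fun n => mul_nonneg (hf n) (by positivity)

theorem coeff_mul_pow_le_eval (hf : ∀ n, 0 ≤ coeff n f) {x : ℝ} (hx : 0 ≤ x)
    (hs : f ∈ absSummable x) (n : ℕ) : coeff n f * x ^ n ≤ eval x f :=
  (hasSum_eval hs (by rw [Real.norm_of_nonneg hx])).summable.le_tsum n
    fun n _ => mul_nonneg (hf n) (by positivity)

theorem continuousOn_eval (hf : f ∈ absSummable r) :
    ContinuousOn (fun z : 𝕜 => eval z f) (Metric.closedBall 0 r) := by
  refine continuousOn_tsum (fun n => by fun_prop) hf fun n z hz => ?_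
  have hz : ‖z‖ ≤ r := by simpa using hz
  rw [norm_mul, norm_mul, norm_pow, norm_pow, RCLike.norm_ofReal]
  gcongr
  · exact le_rfl
  · exact hz.trans (le_abs_self r)

theorem euler_mem_absSummable (hf : f ∈ absSummable r) (hs : 0 ≤ s) (hsr : s < r) :
    euler f ∈ absSummable s := by
  have hr : 0 < r := hs.trans_lt hsr
  have hq : ‖s / r‖ < 1 := by
    rw [Real.norm_of_nonneg (by positivity), div_lt_one hr]; exact hsr
  have h := summable_pow_mul_geometric_of_norm_lt_one 1 hq
  have hb : ∃ K, ∀ n : ℕ, ‖(n : ℝ) ^ 1 * (s / r) ^ n‖ ≤ K := by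
    obtain ⟨K, hK⟩ := h.tendsto_atTop_zero.norm.bddAbove_range
    exact ⟨K, fun n => hK ⟨n, rfl⟩⟩
  obtain ⟨K, hK⟩ := hb
  refine Summable.of_nonneg_of_le (fun _ => norm_nonneg _) (fun n => ?_) (hf.mul_left K)
  have : coeff n (euler f) * s ^ n = ((n : ℝ) ^ 1 * (s / r) ^ n) * (coeff n f * r ^ n) := by
    rw [coeff_euler, div_pow]; field_simp
  rw [this, norm_mul]
  gcongr
  exact hK n

/-- A series vanishing at `r` whose Euler derivative converges absolutely at `r` has a complex
derivative there, within the disc. -/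
theorem tendsto_eval_div_sub (hr : 0 < r) (hf : f ∈ absSummable r) (hf' : euler f ∈ absSummable r)
    (h0 : eval r f = 0) :
    Tendsto (fun z : ℂ => eval z f / (z - r)) (𝓝[Metric.ball 0 r] (r : ℂ))
      (𝓝 ((eval r (euler f) / r : ℝ) : ℂ)) := by
  have key : Tendsto (fun z : ℂ => ∑' n, ((coeff n f : ℝ) : ℂ) *
      ∑ i ∈ Finset.range n, z ^ i * (r : ℂ) ^ (n - 1 - i)) (𝓝[Metric.ball 0 r] (r : ℂ))
      (𝓝 (∑' n, ((coeff n f : ℝ) : ℂ) * ∑ i ∈ Finset.range n, (r : ℂ) ^ i * (r : ℂ) ^ (n - 1 - i))) := by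
    refine tendsto_tsum_of_dominated_convergence
      (bound := fun n => ‖coeff n (euler f) * r ^ n‖ / r) (hf'.div_const r) (fun n => ?_) ?_
    · refine Tendsto.mono_left ?_ nhdsWithin_le_nhds
      exact Continuous.tendsto (f := fun z : ℂ => ((coeff n f : ℝ) : ℂ) *
        ∑ i ∈ Finset.range n, z ^ i * (r : ℂ) ^ (n - 1 - i)) (by fun_prop) _
    · filter_upwards [self_mem_nhdsWithin] with z hz n
      have hz : ‖z‖ ≤ r := by simpa using (Metric.mem_ball.mp hz).le
      have : ‖∑ i ∈ Finset.range n, z ^ i * (r : ℂ) ^ (n - 1 - i)‖ ≤ n * r ^ n / r := by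
        refine (norm_sum_le _ _).trans ?_
        have : ∀ i ∈ Finset.range n, ‖z ^ i * (r : ℂ) ^ (n - 1 - i)‖ ≤ r ^ n / r := by
          intro i hi
          have hi := Finset.mem_range.mp hi
          rw [norm_mul, norm_pow, norm_pow, Complex.norm_real, Real.norm_of_nonneg hr.le,
            le_div_iff₀ hr]
          calc ‖z‖ ^ i * r ^ (n - 1 - i) * r ≤ r ^ i * r ^ (n - 1 - i) * r := by gcongr
            _ = r ^ n := by rw [← pow_add, ← pow_succ]; congr 1; omega
        refine (Finset.sum_le_card_nsmul _ _ _ this).trans ?_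
        simp [mul_div_assoc]
      rw [norm_mul, coeff_euler, norm_mul, norm_mul, Complex.norm_real, norm_pow,
        Real.norm_of_nonneg hr.le, Real.norm_of_nonneg (Nat.cast_nonneg n)]
      calc _ ≤ ‖coeff n f‖ * (n * r ^ n / r) := by gcongr
        _ = _ := by ring
  have e1 : ∑' n, ((coeff n f : ℝ) : ℂ) * ∑ i ∈ Finset.range n, (r : ℂ) ^ i * (r : ℂ) ^ (n - 1 - i) =
      ((eval r (euler f) / r : ℝ) : ℂ) := by
    rw [eval, ← tsum_div_const, Complex.ofReal_tsum]
    refine tsum_congr fun n => ?_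
    have : ∀ i ∈ Finset.range n, (r : ℂ) ^ i * (r : ℂ) ^ (n - 1 - i) = (r : ℂ) ^ n / r := by
      intro i hi
      have hi := Finset.mem_range.mp hi
      rw [eq_div_iff (by exact_mod_cast hr.ne'), ← pow_add, ← pow_succ]; congr 1; omega
    rw [Finset.sum_congr rfl this, coeff_euler]
    simp
    ring
  rw [e1] at key
  refine key.congr' ?_
  filter_upwards [self_mem_nhdsWithin] with z hz
  have hz : ‖z‖ < r := by simpa using hz
  have hzr : z - r ≠ 0 := by
    intro h
    rw [sub_eq_zero.mp h, Complex.norm_real, Real.norm_of_nonneg hr.le] at hz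
    exact hz.false
  have h0' : eval (r : ℂ) f = 0 := by rw [eval_ofReal, h0, Complex.ofReal_zero]
  have hrn : ‖(r : ℂ)‖ ≤ r := by rw [Complex.norm_real, Real.norm_of_nonneg hr.le]
  rw [eq_div_iff hzr, ← sub_zero (eval z f), ← h0', eval, eval,
    ← Summable.tsum_sub (hasSum_eval hf hz.le).summable (hasSum_eval hf hrn).summable,
    ← tsum_mul_right]
  refine tsum_congr fun n => ?_
  rw [mul_assoc, (Commute.all z (r : ℂ)).geom_sum₂_mul, mul_sub]
  rfl

end

open PowerSeries in
/-- The semiring generated by `T` and the series with nonnegative coefficients whose radius of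
convergence exceeds `ρ`. -/
noncomputable def tameSeries (ρ : ℝ) (T : PowerSeries ℝ) : Subsemiring (PowerSeries ℝ) :=
  Subsemiring.closure ({f | (∀ n, 0 ≤ coeff n f) ∧ ∃ r > ρ, f ∈ absSummable r} ∪ {T})

/-- The sequence `0, H 0, H 1, …`. -/
def shiftSeq {R : Type*} [Zero R] (H : ℕ → R) : ℕ → R
  | 0 => 0
  | k + 1 => H k

theorem sum_range_shiftSeq {R : Type*} [AddCommMonoid R] (H : ℕ → R) (n : ℕ) :
    ∑ k ∈ Finset.range (n + 1), shiftSeq H k = ∑ k ∈ Finset.range n, H k := by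
  rw [Finset.sum_range_succ']
  simp [shiftSeq]

section
open PowerSeries
variable {ρ : ℝ} {T f g : ℝ⟦X⟧}

theorem T_mem_tameSeries : T ∈ tameSeries ρ T := Subsemiring.subset_closure (Or.inr rfl)

theorem mem_tameSeries_of_lt {r : ℝ} (hf : ∀ n, 0 ≤ coeff n f) (hr : ρ < r)
    (hfr : f ∈ absSummable r) : f ∈ tameSeries ρ T :=
  Subsemiring.subset_closure (Or.inl ⟨hf, r, hr, hfr⟩)

theorem C_mem_tameSeries {c : ℝ} (hc : 0 ≤ c) : C c ∈ tameSeries ρ T :=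
  mem_tameSeries_of_lt (fun n => by rw [coeff_C]; split_ifs <;> simp [hc]) (lt_add_one ρ)
    (C_mem_absSummable c)

theorem X_mem_tameSeries : (X : ℝ⟦X⟧) ∈ tameSeries ρ T :=
  mem_tameSeries_of_lt (fun n => by rw [coeff_X]; split_ifs <;> simp) (lt_add_one ρ)
    X_mem_absSummable

theorem coeff_nonneg_of_mem_tameSeries (hT : ∀ n, 0 ≤ coeff n T) (hf : f ∈ tameSeries ρ T) (n : ℕ) :
    0 ≤ coeff n f := by
  induction hf using Subsemiring.closure_induction generalizing n with
  | mem f hf =>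
    rcases hf with hf | rfl
    · exact hf.1 n
    · exact hT n
  | zero => simp
  | one => rw [coeff_one]; split_ifs <;> simp
  | add f g _ _ hf hg => rw [map_add]; exact add_nonneg (hf n) (hg n)
  | mul f g _ _ hf hg =>
    rw [coeff_mul]; exact Finset.sum_nonneg fun x _ => mul_nonneg (hf _) (hg _)

theorem absSummable_of_mem_tameSeries (hρ : 0 ≤ ρ) (hT : T ∈ absSummable ρ)
    (hf : f ∈ tameSeries ρ T) : f ∈ absSummable ρ := by
  induction hf using Subsemiring.closure_induction with
  | mem f hf =>
    rcases hf with ⟨_, r, hr, hf⟩ | rfl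
    · exact absSummable_mono hρ hr.le hf
    · exact hT
  | zero => exact zero_mem _
  | one => exact one_mem _
  | add f g _ _ hf hg => exact add_mem hf hg
  | mul f g _ _ hf hg => exact mul_mem hf hg

theorem euler_mem_tameSeries {r : ℝ} (hρ : 0 ≤ ρ) (hf : ∀ n, 0 ≤ coeff n f) (hr : ρ < r)
    (hfr : f ∈ absSummable r) : euler f ∈ tameSeries ρ T := by
  obtain ⟨s, h1, h2⟩ := exists_between hr
  refine mem_tameSeries_of_lt (fun n => ?_) h1
    (euler_mem_absSummable hfr (hρ.trans h1.le) h2)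
  rw [coeff_euler]; exact mul_nonneg (by positivity) (hf n)

theorem exists_euler_eq_of_mem_tameSeries (hρ : 0 ≤ ρ) (hf : f ∈ tameSeries ρ T) :
    ∃ u ∈ tameSeries ρ T, ∃ v ∈ tameSeries ρ T, euler f = u * euler T + v := by
  induction hf using Subsemiring.closure_induction with
  | mem f hf =>
    rcases hf with ⟨h0, r, hr, hf⟩ | rfl
    · exact ⟨0, zero_mem _, euler f, euler_mem_tameSeries hρ h0 hr hf, by simp⟩
    · exact ⟨1, one_mem _, 0, zero_mem _, by simp⟩
  | zero => exact ⟨0, zero_mem _, 0, zero_mem _, by simp⟩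
  | one => exact ⟨0, zero_mem _, 0, zero_mem _, by simp⟩
  | add f g _ _ hf hg =>
    obtain ⟨u, hu, v, hv, e⟩ := hf
    obtain ⟨u', hu', v', hv', e'⟩ := hg
    exact ⟨u + u', add_mem hu hu', v + v', add_mem hv hv', by rw [map_add, e, e']; ring⟩
  | mul f g hf0 hg0 hf hg =>
    obtain ⟨u, hu, v, hv, e⟩ := hf
    obtain ⟨u', hu', v', hv', e'⟩ := hg
    refine ⟨f * u' + g * u, add_mem (mul_mem hf0 hu') (mul_mem hg0 hu),
      f * v' + g * v, add_mem (mul_mem hf0 hv') (mul_mem hg0 hv), ?_⟩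
    rw [Derivation.leibniz, e, e', smul_eq_mul, smul_eq_mul]; ring

/-- The complete homogeneous symmetric functions `H k` in terms of the power sums `p 0, p 1, …`. -/
structure IsComplete {R : Type*} [CommSemiring R] (p H : ℕ → R) : Prop where
  zero : H 0 = 1
  succ : ∀ k : ℕ, ((k : R) + 1) * H (k + 1) = ∑ i ∈ Finset.range (k + 1), p i * H (k - i)

theorem IsComplete.sum_shiftSeq {R : Type*} [CommSemiring R] {p H : ℕ → R} (hH : IsComplete p H)
    (k : ℕ) : ∑ i ∈ Finset.range (k + 1), p i * shiftSeq H (k - i) = k * H k := by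
  cases k with
  | zero => simp [shiftSeq]
  | succ k =>
    rw [Finset.sum_range_succ]
    push_cast
    rw [hH.succ]
    simp only [Nat.sub_self, shiftSeq, mul_zero, add_zero]
    refine Finset.sum_congr rfl fun i hi => ?_
    have := Finset.mem_range.mp hi
    rw [show k + 1 - i = (k - i) + 1 by omega]

variable {p H : ℕ → ℝ⟦X⟧}

theorem IsComplete.succ_eq (hH : IsComplete p H) (k : ℕ) :
    H (k + 1) = C (1 / ((k : ℝ) + 1)) * ∑ i ∈ Finset.range (k + 1), p i * H (k - i) := by
  rw [← hH.succ, ← mul_assoc]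
  have : ((k : ℝ⟦X⟧) + 1) = C ((k : ℝ) + 1) := by simp
  rw [this, ← map_mul, one_div_mul_cancel (by positivity)]
  simp

theorem IsComplete.mem_tameSeries (hH : IsComplete p H) (h0 : p 0 = T)
    (hp : ∀ i, (∀ n, 0 ≤ coeff n (p (i + 1))) ∧ ∃ r > ρ, p (i + 1) ∈ absSummable r) (k : ℕ) :
    H k ∈ tameSeries ρ T := by
  induction k using Nat.strong_induction_on with
  | _ k ih =>
    cases k with
    | zero => rw [hH.zero]; exact one_mem _
    | succ k =>
      rw [hH.succ_eq]
      refine mul_mem (C_mem_tameSeries (by positivity)) (sum_mem fun i hi => mul_mem ?_ (ih _ (by omega)))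
      cases i with
      | zero => rw [h0]; exact T_mem_tameSeries
      | succ i =>
        obtain ⟨h1, r, hr, h2⟩ := hp i
        exact mem_tameSeries_of_lt h1 hr h2

theorem IsComplete.exists_euler_eq (hH : IsComplete p H) (hρ : 0 ≤ ρ) (h0 : p 0 = T)
    (hp : ∀ i, (∀ n, 0 ≤ coeff n (p (i + 1))) ∧ ∃ r > ρ, p (i + 1) ∈ absSummable r) (k : ℕ) :
    ∃ G ∈ tameSeries ρ T, euler (H k) = shiftSeq H k * euler T + G := by
  induction k using Nat.strong_induction_on with
  | _ k ih =>
    cases k with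
    | zero => exact ⟨0, zero_mem _, by simp [hH.zero, shiftSeq]⟩
    | succ k =>
      have : ∀ i, ∃ G ∈ tameSeries ρ T, euler (H (k - i)) = shiftSeq H (k - i) * euler T + G :=
        fun i => ih _ (by omega)
      choose G hG1 hG2 using this
      have hpe : ∀ i, ∃ e ∈ tameSeries ρ T, euler (p i) = (if i = 0 then euler T else 0) + e := by
        intro i
        cases i with
        | zero => exact ⟨0, zero_mem _, by simp [h0]⟩
        | succ i =>
          obtain ⟨h1, r, hr, h2⟩ := hp i
          exact ⟨_, euler_mem_tameSeries hρ h1 hr h2, by simp⟩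
      choose e he1 he2 using hpe
      have hpm : ∀ i, p i ∈ tameSeries ρ T := by
        intro i
        cases i with
        | zero => rw [h0]; exact T_mem_tameSeries
        | succ i =>
          obtain ⟨h1, r, hr, h2⟩ := hp i
          exact mem_tameSeries_of_lt h1 hr h2
      refine ⟨C (1 / ((k : ℝ) + 1)) * ∑ i ∈ Finset.range (k + 1), (e i * H (k - i) + p i * G i),
        mul_mem (C_mem_tameSeries (by positivity)) (sum_mem fun i hi => add_mem
          (mul_mem (he1 i) (hH.mem_tameSeries h0 hp _)) (mul_mem (hpm i) (hG1 i))), ?_⟩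
      have h1 : euler (∑ i ∈ Finset.range (k + 1), p i * H (k - i)) =
          ((k : ℝ⟦X⟧) + 1) * H k * euler T +
            ∑ i ∈ Finset.range (k + 1), (e i * H (k - i) + p i * G i) := by
        rw [map_sum, add_mul, ← hH.sum_shiftSeq k, one_mul, add_mul]
        have : H k * euler T =
            ∑ i ∈ Finset.range (k + 1), (if i = 0 then euler T else 0) * H (k - i) := by
          rw [Finset.sum_eq_single 0] <;> simp +contextual [mul_comm]
        rw [this, Finset.sum_mul, ← Finset.sum_add_distrib, ← Finset.sum_add_distrib]
        refine Finset.sum_congr rfl fun i _ => ?_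
        rw [Derivation.leibniz, hG2, he2, smul_eq_mul, smul_eq_mul]
        ring
      have h2 : euler (C (1 / ((k : ℝ) + 1)) * ∑ i ∈ Finset.range (k + 1), p i * H (k - i)) =
          C (1 / ((k : ℝ) + 1)) * euler (∑ i ∈ Finset.range (k + 1), p i * H (k - i)) := by
        rw [← smul_eq_C_mul, Derivation.map_smul, smul_eq_C_mul]
      rw [hH.succ_eq, h2, h1, mul_add, ← mul_assoc, ← mul_assoc]
      have : C (1 / ((k : ℝ) + 1)) * ((k : ℝ⟦X⟧) + 1) = 1 := by
        have : ((k : ℝ⟦X⟧) + 1) = C ((k : ℝ) + 1) := by simp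
        rw [this, ← map_mul, one_div_mul_cancel (by positivity), map_one]
      rw [this, one_mul]
      rfl

/-- The differential system satisfied by the generating functions of trees. -/
theorem exists_euler_system {d : ℕ} {t : ℝ⟦X⟧} (hρ : 0 ≤ ρ) (hT : T ∈ absSummable ρ)
    (hT0 : ∀ n, 0 ≤ coeff n T) (hH : IsComplete p H) (h0 : p 0 = T)
    (hp : ∀ i, (∀ n, 0 ≤ coeff n (p (i + 1))) ∧ ∃ r > ρ, p (i + 1) ∈ absSummable r)
    (hTH : T = X * ∑ k ∈ Finset.range (d + 3), H k)
    (ht : 2 * t + T ^ 2 = 2 * (X * ∑ k ∈ Finset.range (d + 4), H k) + p 1) :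
    ∃ L ∈ absSummable ρ, ∃ B ∈ absSummable ρ, ∃ M ∈ absSummable ρ, ∃ u ∈ absSummable ρ,
      (∀ n, coeff n T ≤ coeff n L) ∧ (∀ n, coeff n T ≤ coeff n u) ∧
      euler T * (1 - X * ∑ k ∈ Finset.range (d + 2), H k) = L ∧
      (1 - X * ∑ k ∈ Finset.range (d + 2), H k) * euler (X * ∑ k ∈ Finset.range (d + 2), H k) =
        (X * ∑ k ∈ Finset.range (d + 1), H k) * L +
          (1 - X * ∑ k ∈ Finset.range (d + 2), H k) * B ∧
      euler (euler (euler t)) * (1 - X * ∑ k ∈ Finset.range (d + 2), H k) ^ 3 =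
        (1 - X * ∑ k ∈ Finset.range (d + 2), H k) * M +
          u * (X * ∑ k ∈ Finset.range (d + 1), H k) * L ^ 2 := by
  have hHm := hH.mem_tameSeries h0 hp
  choose G hG1 hG2 using hH.exists_euler_eq hρ h0 hp
  have hsum : ∀ n, X * ∑ k ∈ Finset.range n, H k ∈ tameSeries ρ T := fun n =>
    mul_mem X_mem_tameSeries (sum_mem fun i _ => hHm i)
  have hGsum : ∀ n, X * ∑ k ∈ Finset.range n, G k ∈ tameSeries ρ T := fun n =>
    mul_mem X_mem_tameSeries (sum_mem fun i _ => hG1 i)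
  have heX : euler (X : ℝ⟦X⟧) = X := by
    ext n; rw [coeff_euler, coeff_X]; split_ifs with h <;> simp [h]
  have hDsum : ∀ n, euler (X * ∑ k ∈ Finset.range (n + 1), H k) =
      X * ∑ k ∈ Finset.range (n + 1), H k + (X * ∑ k ∈ Finset.range n, H k) * euler T +
        X * ∑ k ∈ Finset.range (n + 1), G k := by
    intro n
    rw [Derivation.leibniz, heX, map_sum, Finset.sum_congr rfl fun k _ => hG2 k,
      Finset.sum_add_distrib, ← Finset.sum_mul, sum_range_shiftSeq, smul_eq_mul, smul_eq_mul]
    ring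
  have hA := fun {f} => absSummable_of_mem_tameSeries (f := f) hρ hT
  have hN := fun {f} => coeff_nonneg_of_mem_tameSeries (f := f) (ρ := ρ) hT0
  set Q := X * ∑ k ∈ Finset.range (d + 2), H k with hQ
  set R := X * ∑ k ∈ Finset.range (d + 1), H k with hR
  set P := X * ∑ k ∈ Finset.range (d + 4), H k with hP
  set L := T + X * ∑ k ∈ Finset.range (d + 3), G k with hL
  set B := Q + X * ∑ k ∈ Finset.range (d + 2), G k with hB
  have e1 : euler T * (1 - Q) = L := by
    have := hDsum (d + 2)
    rw [← hTH] at this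
    linear_combination this
  have e2 : euler Q = B + R * euler T := by
    rw [hQ, hDsum (d + 1)]; ring
  have hDP : euler P = P + T * euler T + X * ∑ k ∈ Finset.range (d + 4), G k := by
    have := hDsum (d + 3)
    rwa [← hTH] at this
  obtain ⟨h11, r, hr, h12⟩ := hp 0
  rw [zero_add] at h11 h12
  have hDp := euler_mem_tameSeries (T := T) hρ h11 hr h12
  have hDDp : euler (euler (p 1)) ∈ tameSeries ρ T := by
    obtain ⟨s, h1, h2⟩ := exists_between hr
    refine euler_mem_tameSeries hρ (hN hDp) h1 (euler_mem_absSummable h12 (hρ.trans h1.le) h2)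
  have h2 : euler (2 : ℝ⟦X⟧) = 0 := by
    have := euler.map_natCast 2
    rwa [Nat.cast_ofNat] at this
  set c : ℝ⟦X⟧ := C (1 / 2) with hc
  have h2c : 2 * c = 1 := by
    have : (2 : ℝ⟦X⟧) = C 2 := (map_ofNat C 2).symm
    rw [this, hc, ← map_mul]; norm_num
  have hDt : euler t = P + X * ∑ k ∈ Finset.range (d + 4), G k + c * euler (p 1) := by
    have := congrArg euler ht
    rw [map_add, map_add, Derivation.leibniz, Derivation.leibniz, h2, pow_two, Derivation.leibniz,
      hDP] at this
    simp only [smul_eq_mul] at this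
    linear_combination c * this - (euler t - P - X * ∑ k ∈ Finset.range (d + 4), G k) * h2c
  obtain ⟨u', hu', v', hv', euv⟩ := exists_euler_eq_of_mem_tameSeries hρ (hGsum (d + 4))
  have hec : euler c = 0 := by
    ext n; rw [coeff_euler, hc, coeff_C]; split_ifs with h <;> simp [h]
  set u := T + u' with hu
  set w := P + X * ∑ k ∈ Finset.range (d + 4), G k + v' + c * euler (euler (p 1)) with hw
  have hcm : c ∈ tameSeries ρ T := C_mem_tameSeries (by norm_num)
  have hum : u ∈ tameSeries ρ T := add_mem T_mem_tameSeries hu'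
  have hwm : w ∈ tameSeries ρ T :=
    add_mem (add_mem (add_mem (hsum _) (hGsum _)) hv') (mul_mem hcm hDDp)
  have hDDt : euler (euler t) = u * euler T + w := by
    rw [hDt, map_add, map_add, hDP, euv, Derivation.leibniz, hec]
    simp only [smul_eq_mul]
    rw [hu, hw]; ring
  obtain ⟨u1, hu1, v1, hv1, eu⟩ := exists_euler_eq_of_mem_tameSeries hρ hum
  obtain ⟨u2, hu2, v2, hv2, ew⟩ := exists_euler_eq_of_mem_tameSeries hρ hwm
  have hLm : L ∈ tameSeries ρ T := add_mem T_mem_tameSeries (hGsum _)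
  have hBm : B ∈ tameSeries ρ T := add_mem (hsum _) (hGsum _)
  obtain ⟨l1, hl1, l2, hl2, eL⟩ := exists_euler_eq_of_mem_tameSeries hρ hLm
  have hDDT : euler (euler T) * (1 - Q) = euler L + euler T * euler Q := by
    rw [← e1, Derivation.leibniz, map_sub, Derivation.map_one_eq_zero]
    simp only [smul_eq_mul]; ring
  have hQA := hA (hsum (d + 2))
  have h1Q : 1 - Q ∈ absSummable ρ := sub_mem (one_mem _) hQA
  have hLA := hA hLm
  refine ⟨L, hLA, B, hA hBm, u1 * L ^ 2 + (1 - Q) * (v1 * L) +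
    u * (l1 * L + (1 - Q) * l2) + u * L * B + (1 - Q) * (u2 * L) + (1 - Q) ^ 2 * v2, ?_,
    u, hA hum, ?_, ?_, e1, ?_, ?_⟩
  · refine add_mem (add_mem (add_mem (add_mem (add_mem (mul_mem (hA hu1) (pow_mem hLA 2))
      (mul_mem h1Q (mul_mem (hA hv1) hLA))) (mul_mem (hA hum) (add_mem (mul_mem (hA hl1) hLA)
      (mul_mem h1Q (hA hl2))))) (mul_mem (mul_mem (hA hum) hLA) (hA hBm)))
      (mul_mem h1Q (mul_mem (hA hu2) hLA))) (mul_mem (pow_mem h1Q 2) (hA hv2))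
  · intro n; rw [hL, map_add]; linarith [hN (hGsum (d + 3)) n]
  · intro n; rw [hu, map_add]; linarith [hN hu' n]
  · rw [e2]; linear_combination R * e1
  · rw [hDDt, map_add, Derivation.leibniz, eu, ew]
    simp only [smul_eq_mul]
    rw [e2, eL] at hDDT
    generalize euler T = y at *
    generalize euler y = y2 at *
    rw [← e1]
    linear_combination u * (1 - Q) ^ 2 * hDDT

end

theorem pow_three_eq_cpow {a b : ℂ} (ha : 0 < a.re) (hb : 0 < b.re) {c : ℂ} (hc : 0 < c.re)
    (h : c ^ 2 = a * b) : c ^ 3 = a ^ (3 / 2 : ℂ) * b ^ (3 / 2 : ℂ) := by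
  have ha0 : a ≠ 0 := by rintro rfl; simp at ha
  have hb0 : b ≠ 0 := by rintro rfl; simp at hb
  have h1 := abs_lt.mp (Complex.abs_arg_lt_pi_div_two_iff.mpr (Or.inl ha))
  have h2 := abs_lt.mp (Complex.abs_arg_lt_pi_div_two_iff.mpr (Or.inl hb))
  have hl := Complex.log_mul ha0 hb0 ⟨by linarith, by linarith⟩
  have e : c = (a * b) ^ (2⁻¹ : ℂ) := by rw [← h, Complex.sq_cpow_two_inv hc]
  rw [e, ← Complex.cpow_nat_mul, Complex.cpow_def_of_ne_zero (mul_ne_zero ha0 hb0),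
    Complex.cpow_def_of_ne_zero ha0, Complex.cpow_def_of_ne_zero hb0, hl, ← Complex.exp_add]
  congr 1
  push_cast
  ring

section
open PowerSeries
variable {ρ : ℝ} {Q L B M u R t : ℝ⟦X⟧}

/-- A series with nonnegative coefficients and value `1` at `ρ` stays away from `1` elsewhere in the
disc of radius `ρ`. -/
theorem coeff_one_mul_le_re_one_sub_eval (hρ : 0 < ρ) (hQ : Q ∈ absSummable ρ)
    (hQ0 : ∀ n, 0 ≤ coeff n Q) (hQ1 : eval ρ Q = 1) {z : ℂ} (hz : ‖z‖ ≤ ρ) :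
    coeff 1 Q * (ρ - z.re) ≤ (1 - eval z Q).re := by
  have h1 : HasSum (fun n => coeff n Q * ρ ^ n) 1 := by
    have := hasSum_eval (𝕜 := ℝ) (z := ρ) hQ (by rw [Real.norm_of_nonneg hρ.le])
    rw [hQ1] at this
    simpa using this
  have h2 : HasSum (fun n => coeff n Q * (z ^ n).re) (eval z Q).re := by
    have := Complex.hasSum_re (hasSum_eval (𝕜 := ℂ) hQ hz)
    refine this.congr_fun ?_ |> id
    intro n
    simp
  have h3 := h1.sub h2
  rw [Complex.sub_re, Complex.one_re]
  have hle : ∀ n, (z ^ n).re ≤ ρ ^ n := fun n => (Complex.re_le_norm _).trans (by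
    rw [norm_pow]; gcongr)
  have := h3.summable.le_tsum 1 fun n _ => by
    have := mul_le_mul_of_nonneg_left (hle n) (hQ0 n)
    linarith
  rw [h3.tsum_eq] at this
  simpa [mul_sub] using this

/-- A square-root singularity of the generating function forces `n ^ (-5 / 2)` behaviour. -/
theorem tendsto_coeff_of_system (hρ : 0 < ρ) (hQ : Q ∈ absSummable ρ) (hL : L ∈ absSummable ρ)
    (hB : B ∈ absSummable ρ) (hM : M ∈ absSummable ρ) (hu : u ∈ absSummable ρ)
    (hR : R ∈ absSummable ρ) (ht : t ∈ absSummable ρ) (hQ0 : ∀ n, 0 ≤ coeff n Q)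
    (hQc : 0 < coeff 1 Q) (hQ1 : eval ρ Q = 1)
    (hLpos : 0 < eval ρ L) (hupos : 0 < eval ρ u) (hRpos : 0 < eval ρ R)
    (e1 : (1 - Q) * euler Q = R * L + (1 - Q) * B)
    (e2 : euler (euler (euler t)) * (1 - Q) ^ 3 = (1 - Q) * M + u * R * L ^ 2) :
    ∃ τ : ℝ, 0 < τ ∧
      Tendsto (fun n : ℕ => coeff n t * (n : ℝ) ^ ((5 : ℝ) / 2) * ρ ^ n) atTop (𝓝 τ) := by
  have hρn : ‖ρ‖ ≤ ρ := by rw [Real.norm_of_nonneg hρ.le]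
  have h1Q : 1 - Q ∈ absSummable ρ := sub_mem (one_mem _) hQ
  have hURL : u * R * L ^ 2 ∈ absSummable ρ := mul_mem (mul_mem hu hR) (pow_mem hL 2)
  set N := (1 - Q) * M + u * R * L ^ 2 with hNdef
  have hN : N ∈ absSummable ρ := add_mem (mul_mem h1Q hM) hURL
  have h1Qe : ∀ {z : ℂ}, ‖z‖ ≤ ρ → eval z (1 - Q) = 1 - eval z Q := fun hz => by
    rw [eval_sub (one_mem _) hQ hz, eval_one]
  have h1Q0 : eval ρ (1 - Q) = 0 := by rw [eval_sub (one_mem _) hQ hρn, eval_one, hQ1, sub_self]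
  have hNpos : 0 < eval ρ N := by
    rw [hNdef, eval_add (mul_mem h1Q hM) hURL hρn, eval_mul h1Q hM hρn, h1Q0, zero_mul, zero_add,
      eval_mul (mul_mem hu hR) (pow_mem hL 2) hρn, eval_mul hu hR hρn, eval_pow hL hρn]
    positivity
  -- the square of `1 - Q` is differentiable at `ρ`
  have hEm : (1 - Q) ^ 2 ∈ absSummable ρ := pow_mem h1Q 2
  have hE' : euler ((1 - Q) ^ 2) = - (2 * (R * L + (1 - Q) * B)) := by
    rw [← e1, pow_two, Derivation.leibniz, map_sub, Derivation.map_one_eq_zero]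
    simp only [smul_eq_mul]; ring
  have h2m : (2 : ℝ⟦X⟧) ∈ absSummable ρ := ofNat_mem _ 2
  have hRLB : R * L + (1 - Q) * B ∈ absSummable ρ := add_mem (mul_mem hR hL) (mul_mem h1Q hB)
  have hE'm : euler ((1 - Q) ^ 2) ∈ absSummable ρ := by
    rw [hE']; exact neg_mem (mul_mem h2m hRLB)
  have hE0 : eval ρ ((1 - Q) ^ 2) = 0 := by rw [eval_pow h1Q hρn, h1Q0]; simp
  set K := 2 * (eval ρ R * eval ρ L) with hK
  have hKpos : 0 < K := by positivity
  have hE'e : eval ρ (euler ((1 - Q) ^ 2)) = - K := by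
    have h2e : eval ρ (2 : ℝ⟦X⟧) = 2 := by
      have := eval_C (z := ρ) 2
      rw [map_ofNat] at this; simpa using this
    rw [hE', eval_neg, eval_mul h2m hRLB hρn, eval_add (mul_mem hR hL) (mul_mem h1Q hB) hρn,
      eval_mul hR hL hρn, eval_mul h1Q hB hρn, h1Q0, h2e, hK]
    ring
  have hdiff := tendsto_eval_div_sub hρ hEm hE'm hE0
  rw [hE'e] at hdiff
  have hρC : (ρ : ℂ) ≠ 0 := by exact_mod_cast hρ.ne'
  have hmap : Tendsto (fun w : ℂ => ρ * w) (𝓝[Metric.ball 0 1] 1) (𝓝[Metric.ball 0 ρ] (ρ : ℂ)) := by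
    refine tendsto_nhdsWithin_iff.mpr ⟨?_, ?_⟩
    · refine Tendsto.mono_left ?_ nhdsWithin_le_nhds
      exact (by fun_prop : Continuous fun w : ℂ => ρ * w).tendsto' _ _ (by simp)
    · filter_upwards [self_mem_nhdsWithin] with w hw
      have hw : ‖w‖ < 1 := by simpa using hw
      have : ‖(ρ : ℂ) * w‖ < ρ := by
        rw [norm_mul, Complex.norm_real, Real.norm_of_nonneg hρ.le]
        nlinarith
      simpa using this
  have hnorm : ∀ {w : ℂ}, ‖w‖ ≤ 1 → ‖(ρ : ℂ) * w‖ ≤ ρ := by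
    intro w hw
    rw [norm_mul, Complex.norm_real, Real.norm_of_nonneg hρ.le]
    nlinarith
  set κ : ℂ → ℂ := fun w => eval (ρ * w : ℂ) ((1 - Q) ^ 2) / (1 - w) with hκ
  have hκlim : Tendsto κ (𝓝[Metric.ball 0 1] 1) (𝓝 (K : ℂ)) := by
    have := (hdiff.comp hmap).const_mul (-(ρ : ℂ))
    have e : -(ρ : ℂ) * ((-K / ρ : ℝ) : ℂ) = K := by
      push_cast; field_simp
    rw [e] at this
    refine this.congr fun w => ?_
    simp only [Function.comp, hκ]
    rw [show (ρ : ℂ) * w - ρ = -(ρ * (1 - w)) by ring, div_neg, mul_neg, neg_mul, neg_neg,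
      mul_div_assoc', mul_div_mul_left _ _ hρC]
  have hQpos : ∀ {w : ℂ}, ‖w‖ ≤ 1 → w ≠ 1 → 0 < (1 - eval (ρ * w : ℂ) Q).re := by
    intro w hw hw1
    refine lt_of_lt_of_le ?_ (coeff_one_mul_le_re_one_sub_eval hρ hQ hQ0 hQ1 (hnorm hw))
    have hre : w.re < 1 := by
      refine lt_of_le_of_ne ((Complex.re_le_norm w).trans hw) fun h => hw1 ?_
      have h2 := Complex.sq_norm w
      rw [Complex.normSq_apply, h] at h2
      have him : w.im = 0 := by nlinarith [norm_nonneg w]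
      exact Complex.ext (by simp [h]) (by simp [him])
    have : (ρ * w : ℂ).re = ρ * w.re := by simp
    rw [this]
    have : 0 < ρ * (1 - w.re) := mul_pos hρ (by linarith)
    exact mul_pos hQc (by linarith)
  -- the third derivative
  set t3 := euler (euler (euler t)) with ht3
  have ht3m : ∀ {s : ℝ}, 0 ≤ s → s < ρ → t3 ∈ absSummable s := by
    intro s hs hsρ
    obtain ⟨s1, h1, h2⟩ := exists_between hsρ
    obtain ⟨s2, h3, h4⟩ := exists_between h1
    exact euler_mem_absSummable (euler_mem_absSummable (euler_mem_absSummable ht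
      (hs.trans h1.le) h2) (hs.trans h3.le) h4) hs h3
  have hlt : ∀ {w : ℂ}, ‖w‖ < 1 → ‖(ρ : ℂ) * w‖ < ρ := by
    intro w hw
    rw [norm_mul, Complex.norm_real, Real.norm_of_nonneg hρ.le]
    nlinarith
  have hG : ∀ {w : ℂ}, ‖w‖ < 1 →
      eval (ρ * w : ℂ) t3 = eval (ρ * w : ℂ) N / (1 - eval (ρ * w : ℂ) Q) ^ 3 := by
    intro w hw
    have hs := hlt hw
    have h0 := norm_nonneg ((ρ : ℂ) * w)
    have hw1 : w ≠ 1 := by rintro rfl; simp at hw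
    have hne : 1 - eval (ρ * w : ℂ) Q ≠ 0 := by
      intro h; have := hQpos hw.le hw1; rw [h] at this; simp at this
    rw [eq_div_iff (pow_ne_zero 3 hne), ← e2, eval_mul (ht3m h0 hs)
      (absSummable_mono h0 hs.le (pow_mem h1Q 3)) le_rfl, eval_pow h1Q hs.le, h1Qe hs.le]
  have hcontN : ContinuousOn (fun w : ℂ => eval (ρ * w : ℂ) N) (Metric.closedBall 0 1) := by
    refine (continuousOn_eval hN).comp (by fun_prop) fun w hw => ?_
    simpa using hnorm (by simpa using hw : ‖w‖ ≤ 1)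
  have hcontQ : ContinuousOn (fun w : ℂ => eval (ρ * w : ℂ) Q) (Metric.closedBall 0 1) := by
    refine (continuousOn_eval hQ).comp (by fun_prop) fun w hw => ?_
    simpa using hnorm (by simpa using hw : ‖w‖ ≤ 1)
  have main := tendsto_coeff_of_singularity
    (c := fun n => ((n ^ 3 * coeff n t * ρ ^ n : ℝ) : ℂ)) (G := fun w => eval (ρ * w : ℂ) t3)
    (D := ((eval ρ N / K ^ (3 / 2 : ℝ) : ℝ) : ℂ)) ?_ ?_ ?_
  · refine ⟨eval ρ N / K ^ (3 / 2 : ℝ) / Real.Gamma (3 / 2), div_pos (by positivity)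
      (Real.Gamma_pos_of_pos (by norm_num)), ?_⟩
    rw [← Complex.ofReal_div] at main
    have m2 : Tendsto (fun n : ℕ => (n ^ 3 * coeff n t * ρ ^ n) / ((n : ℝ) ^ (1 / 2 : ℝ))) atTop
        (𝓝 (eval ρ N / K ^ (3 / 2 : ℝ) / Real.Gamma (3 / 2))) := by
      have := (Complex.continuous_re.tendsto _).comp main
      rw [Complex.ofReal_re] at this
      refine this.congr fun n => ?_
      simp only [Function.comp]
      rw [← Complex.ofReal_div, Complex.ofReal_re]
    refine m2.congr' ?_
    filter_upwards [eventually_gt_atTop 0] with n hn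
    have hn' : (0 : ℝ) < n := by exact_mod_cast hn
    rw [div_eq_iff (by positivity)]
    have : (n : ℝ) ^ 3 = (n : ℝ) ^ ((5 : ℝ) / 2) * (n : ℝ) ^ (1 / 2 : ℝ) := by
      rw [← Real.rpow_add hn', ← Real.rpow_natCast]; norm_num
    rw [this]; ring
  · intro w hw
    have hs := hlt hw
    have := hasSum_eval (ht3m (norm_nonneg _) hs) (le_refl ‖(ρ : ℂ) * w‖)
    refine this.congr_fun ?_ |> id
    intro n
    rw [ht3, coeff_euler, coeff_euler, coeff_euler, mul_pow]
    simp
    ring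
  · have hN' : Tendsto (fun w : ℂ => eval (ρ * w : ℂ) N) (𝓝[Metric.ball 0 1] 1)
        (𝓝 ((eval ρ N : ℝ) : ℂ)) := by
      have := (hcontN 1 (by simp)).tendsto.mono_left
        (nhdsWithin_mono 1 (Metric.ball_subset_closedBall (x := (0 : ℂ)) (ε := 1)))
      rwa [mul_one, eval_ofReal] at this
    have hκ' : Tendsto (fun w => κ w ^ (3 / 2 : ℂ)) (𝓝[Metric.ball 0 1] 1)
        (𝓝 ((K : ℂ) ^ (3 / 2 : ℂ))) :=
      hκlim.cpow tendsto_const_nhds (Complex.ofReal_mem_slitPlane.mpr hKpos)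
    have hKne : (K : ℂ) ^ (3 / 2 : ℂ) ≠ 0 := by
      rw [Complex.cpow_ne_zero_iff]; left; exact_mod_cast hKpos.ne'
    have e : ((eval ρ N / K ^ (3 / 2 : ℝ) : ℝ) : ℂ) = (eval ρ N : ℝ) / (K : ℂ) ^ (3 / 2 : ℂ) := by
      rw [Complex.ofReal_div, Complex.ofReal_cpow hKpos.le]; norm_num
    rw [e]
    refine (hN'.div hκ' hKne).congr' ?_
    have hre : ∀ᶠ w in 𝓝[Metric.ball 0 1] (1 : ℂ), 0 < (κ w).re := by
      have := (Complex.continuous_re.tendsto _).comp hκlim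
      exact this.eventually_const_lt (by simpa using hKpos)
    filter_upwards [hre, self_mem_nhdsWithin] with w hw1 hw2
    have hw2 : ‖w‖ < 1 := by simpa using hw2
    have hwne : w ≠ 1 := by rintro rfl; simp at hw2
    have hwre : 0 < (1 - w).re := by
      have := Complex.re_le_norm w
      simp; linarith
    have hq := hQpos hw2.le hwne
    have h1w : 1 - w ≠ 0 := sub_ne_zero.mpr (Ne.symm hwne)
    have hsq : (1 - eval (ρ * w : ℂ) Q) ^ 2 = κ w * (1 - w) := by
      rw [hκ, ← h1Qe (hnorm hw2.le), ← eval_pow h1Q (hnorm hw2.le)]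
      field_simp
    have h3 := pow_three_eq_cpow hw1 hwre hq hsq
    simp only [Pi.div_apply]
    rw [hG hw2, h3]
    have : (1 - w) ^ (3 / 2 : ℂ) ≠ 0 := by
      rw [Complex.cpow_ne_zero_iff]; left; exact h1w
    rw [div_mul_eq_mul_div, mul_div_mul_right _ _ this]
  · intro δ hδ
    have hKc : IsCompact (Metric.closedBall (0 : ℂ) 1 ∩ {w | δ ≤ ‖1 - w‖}) :=
      (isCompact_closedBall 0 1).inter_right (isClosed_le continuous_const (by fun_prop))
    have hc : ContinuousOn (fun w : ℂ => eval (ρ * w : ℂ) N / (1 - eval (ρ * w : ℂ) Q) ^ 3)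
        (Metric.closedBall (0 : ℂ) 1 ∩ {w | δ ≤ ‖1 - w‖}) := by
      refine (hcontN.mono Set.inter_subset_left).div
        ((continuousOn_const.sub (hcontQ.mono Set.inter_subset_left)).pow 3) fun w hw => ?_
      have hw1 : w ≠ 1 := by
        rintro rfl
        have := hw.2
        simp only [Set.mem_ofPred_eq, sub_self, norm_zero] at this
        linarith
      have := hQpos (by simpa using hw.1 : ‖w‖ ≤ 1) hw1
      refine pow_ne_zero 3 fun h => ?_
      rw [h] at this
      simp at this
    obtain ⟨C, hC⟩ := hKc.exists_bound_of_continuousOn hc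
    refine ⟨C, fun w hw hδw => ?_⟩
    rw [hG hw]
    exact hC w ⟨by simpa using hw.le, hδw⟩

end

/-- The complete homogeneous symmetric functions determined by the power sums `p`. -/
noncomputable def complete (p : ℕ → ℝ) : ℕ → ℝ
  | 0 => 1
  | k + 1 => (∑ i : Fin (k + 1), p i * complete p (k - i)) / (k + 1)
termination_by k => k
decreasing_by omega

theorem complete_zero (p : ℕ → ℝ) : complete p 0 = 1 := by rw [complete]

theorem complete_succ (p : ℕ → ℝ) (k : ℕ) :
    complete p (k + 1) = (∑ i ∈ Finset.range (k + 1), p i * complete p (k - i)) / (k + 1) := by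
  rw [complete, Finset.sum_range]

theorem isComplete_complete (p : ℕ → ℝ) : IsComplete p (complete p) where
  zero := complete_zero p
  succ k := by
    rw [complete_succ]
    field_simp

theorem IsComplete.eq_complete {p H : ℕ → ℝ} (hH : IsComplete p H) (k : ℕ) :
    H k = complete p k := by
  induction k using Nat.strong_induction_on with
  | _ k ih =>
    cases k with
    | zero => rw [hH.zero, complete_zero]
    | succ k =>
      rw [complete_succ, eq_div_iff (by positivity), mul_comm, hH.succ]
      exact Finset.sum_congr rfl fun i _ => by rw [ih _ (by omega)]

theorem continuous_complete (k : ℕ) : Continuous fun p : ℕ → ℝ => complete p k := by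
  induction k using Nat.strong_induction_on with
  | _ k ih =>
    cases k with
    | zero => simp only [complete_zero]; exact continuous_const
    | succ k =>
      simp only [complete_succ]
      refine Continuous.div_const (continuous_finsetSum _ fun i _ => ?_) _
      exact (continuous_apply i).mul (ih _ (by omega))

theorem hasDerivAt_complete (p : ℕ → ℝ) (y : ℝ) (k : ℕ) :
    HasDerivAt (fun y => complete (Function.update p 0 y) k)
      (shiftSeq (complete (Function.update p 0 y)) k) y := by
  induction k using Nat.strong_induction_on with
  | _ k ih =>
    cases k with
    | zero => simp only [complete_zero, shiftSeq]; exact hasDerivAt_const _ _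
    | succ k =>
      simp only [complete_succ]
      have h0 : ∀ i, HasDerivAt (fun y => Function.update p 0 y i) (if i = 0 then 1 else 0) y := by
        intro i
        split_ifs with h
        · subst h; simpa using hasDerivAt_id' y
        · simp only [Function.update_of_ne h]; exact hasDerivAt_const _ _
      have h1 := HasDerivAt.fun_sum (u := Finset.range (k + 1)) (x := y)
        fun i _ => (h0 i).fun_mul (ih (k - i) (by omega))
      refine (h1.div_const ((k : ℝ) + 1)).congr_deriv ?_
      rw [Finset.sum_add_distrib, (isComplete_complete _).sum_shiftSeq k,
        Finset.sum_eq_single 0]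
      · simp only [shiftSeq, if_true, Nat.sub_zero]
        field_simp
        ring
      · intro i _ hi; simp [hi]
      · simp

theorem sum_range_antidiagonal_le {f g : ℕ → ℝ} (hf : ∀ n, 0 ≤ f n) (hg : ∀ n, 0 ≤ g n) (N : ℕ) :
    ∑ m ∈ Finset.range N, ∑ x ∈ Finset.HasAntidiagonal.antidiagonal m, f x.1 * g x.2 ≤
      (∑ m ∈ Finset.range N, f m) * ∑ m ∈ Finset.range N, g m := by
  rw [Finset.sum_mul_sum, ← Finset.sum_product']
  have h : ∀ m ∈ Finset.range N, Finset.HasAntidiagonal.antidiagonal m =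
      (Finset.range N ×ˢ Finset.range N).filter fun x => x.1 + x.2 = m := by
    intro m hm
    ext x
    have := Finset.mem_range.mp hm
    simp only [Finset.mem_filter, Finset.mem_product, Finset.mem_range,
      Finset.HasAntidiagonal.mem_antidiagonal]
    omega
  rw [Finset.sum_congr rfl fun m hm => by rw [h m hm]]
  exact Finset.sum_fiberwise_le_sum_of_sum_fiber_nonneg fun _ _ =>
    Finset.sum_nonneg fun x _ => mul_nonneg (hf _) (hg _)

/-- The recurrences linking the numbers `a n` of planted trees, `t n` of trees and `h k m` of forests
of `k` planted trees with `m` vertices in total. -/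
structure IsTreeCount (Δ : ℕ) (a t : ℕ → ℕ) (h : ℕ → ℕ → ℕ) : Prop where
  h_zero : ∀ m, h 0 m = if m = 0 then 1 else 0
  newton : ∀ k m, (k + 1) * h (k + 1) m =
    ∑ i ∈ Finset.range (k + 1), ∑ x ∈ Finset.HasAntidiagonal.antidiagonal m,
      (if i + 1 ∣ x.1 then a (x.1 / (i + 1)) else 0) * h (k - i) x.2
  a_zero : a 0 = 0
  a_succ : ∀ m, a (m + 1) = ∑ k ∈ Finset.range Δ, h k m
  a_le : ∀ n, a n ≤ 4 ^ n
  dissimilarity : ∀ n, 2 * t n + ∑ x ∈ Finset.HasAntidiagonal.antidiagonal n, a x.1 * a x.2 =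
    2 * shiftSeq (fun m => ∑ k ∈ Finset.range (Δ + 1), h k m) n + if 2 ∣ n then a (n / 2) else 0

/-- The sequence supported on the multiples of `i + 1` with value `a m` at `(i + 1) * m`. -/
def dilate (a : ℕ → ℕ) (i n : ℕ) : ℕ := if i + 1 ∣ n then a (n / (i + 1)) else 0

/-- The generating function of a sequence of natural numbers. -/
noncomputable def ser (u : ℕ → ℕ) : PowerSeries ℝ := PowerSeries.mk fun n => (u n : ℝ)

section
open PowerSeries

theorem coeff_ser (u : ℕ → ℕ) (n : ℕ) : coeff n (ser u) = u n := coeff_mk _ _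

theorem coeff_ser_nonneg (u : ℕ → ℕ) (n : ℕ) : 0 ≤ coeff n (ser u) := by
  rw [coeff_ser]; positivity

theorem dilate_zero (a : ℕ → ℕ) : dilate a 0 = a := by
  funext n; simp [dilate]

theorem ser_dilate_mem_absSummable {a : ℕ → ℕ} {r : ℝ} (i : ℕ)
    (ha : ser a ∈ absSummable (r ^ (i + 1))) : ser (dilate a i) ∈ absSummable r := by
  rw [mem_absSummable] at ha ⊢
  have hinj : Function.Injective fun m : ℕ => (i + 1) * m := fun x y h => by
    simpa using h
  rw [← hinj.summable_iff]
  · refine ha.congr fun n => ?_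
    simp only [Function.comp, coeff_ser, dilate, dvd_mul_right, if_true]
    rw [Nat.mul_div_cancel_left _ (by omega), pow_mul]
  · intro n hn
    have : ¬ i + 1 ∣ n := fun ⟨m, hm⟩ => hn ⟨m, hm.symm⟩
    simp [coeff_ser, dilate, this]

variable {Δ : ℕ} {a t : ℕ → ℕ} {h : ℕ → ℕ → ℕ}

theorem IsTreeCount.isComplete (hc : IsTreeCount Δ a t h) :
    IsComplete (fun i => ser (dilate a i)) (fun k => ser (h k)) where
  zero := by
    ext m
    rw [coeff_ser, hc.h_zero, coeff_one]
    split_ifs <;> simp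
  succ k := by
    ext m
    have : ((k : ℝ⟦X⟧) + 1) = C ((k : ℝ) + 1) := by simp
    rw [this, coeff_C_mul, coeff_ser, map_sum]
    have := congrArg (Nat.cast : ℕ → ℝ) (hc.newton k m)
    push_cast at this
    rw [this]
    refine Finset.sum_congr rfl fun i _ => ?_
    rw [coeff_mul]
    refine Finset.sum_congr rfl fun x _ => ?_
    rw [coeff_ser, coeff_ser, dilate]
    push_cast
    rfl

theorem IsTreeCount.ser_eq (hc : IsTreeCount Δ a t h) :
    ser a = X * ∑ k ∈ Finset.range Δ, ser (h k) := by
  ext n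
  cases n with
  | zero => simp [coeff_ser, hc.a_zero]
  | succ n =>
    rw [coeff_succ_X_mul, coeff_ser, hc.a_succ, map_sum]
    push_cast
    exact Finset.sum_congr rfl fun k _ => (coeff_ser _ _).symm

theorem IsTreeCount.two_mul_ser (hc : IsTreeCount Δ a t h) :
    2 * ser t + ser a ^ 2 =
      2 * (X * ∑ k ∈ Finset.range (Δ + 1), ser (h k)) + ser (dilate a 1) := by
  ext n
  have h2 : (2 : ℝ⟦X⟧) = C 2 := (map_ofNat C 2).symm
  have h3 := congrArg (Nat.cast : ℕ → ℝ) (hc.dissimilarity n)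
  rw [map_add, map_add, h2, coeff_C_mul, coeff_C_mul, pow_two, coeff_mul, coeff_ser, coeff_ser]
  have e1 : coeff n (X * ∑ k ∈ Finset.range (Δ + 1), ser (h k)) =
      ((shiftSeq (fun m => ∑ k ∈ Finset.range (Δ + 1), h k m) n : ℕ) : ℝ) := by
    cases n with
    | zero => simp [shiftSeq]
    | succ n =>
      rw [coeff_succ_X_mul, map_sum, shiftSeq]
      push_cast
      exact Finset.sum_congr rfl fun k _ => coeff_ser _ _
  rw [e1]
  simp only [coeff_ser, dilate]
  push_cast at h3 ⊢
  exact h3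

/-- Partial sums of the forest series are controlled by those of the planted tree series. -/
theorem IsTreeCount.sum_range_le_complete (hc : IsTreeCount Δ a t h) {x : ℝ} (hx : 0 ≤ x) {N : ℕ}
    {q : ℕ → ℝ} (hq : ∀ i, ∑ n ∈ Finset.range N, (dilate a i n : ℝ) * x ^ n ≤ q i) (k : ℕ) :
    ∑ m ∈ Finset.range N, (h k m : ℝ) * x ^ m ≤ complete q k := by
  have hq0 : ∀ i, 0 ≤ q i := fun i =>
    (Finset.sum_nonneg fun n _ => by positivity : (0 : ℝ) ≤ _).trans (hq i)
  induction k using Nat.strong_induction_on with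
  | _ k ih =>
    cases k with
    | zero =>
      rw [complete_zero]
      cases N with
      | zero => simp
      | succ N =>
        rw [Finset.sum_range_succ']
        simp [hc.h_zero]
    | succ k =>
      rw [complete_succ, le_div_iff₀ (by positivity), mul_comm, Finset.mul_sum]
      have e : ∀ m, ((k : ℝ) + 1) * ((h (k + 1) m : ℝ) * x ^ m) =
          ∑ i ∈ Finset.range (k + 1), ∑ y ∈ Finset.HasAntidiagonal.antidiagonal m,
            ((dilate a i y.1 : ℝ) * x ^ y.1) * ((h (k - i) y.2 : ℝ) * x ^ y.2) := by
        intro m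
        have := congrArg (Nat.cast : ℕ → ℝ) (hc.newton k m)
        push_cast at this
        rw [← mul_assoc, this, Finset.sum_mul]
        refine Finset.sum_congr rfl fun i _ => ?_
        rw [Finset.sum_mul]
        refine Finset.sum_congr rfl fun y hy => ?_
        have hy : y.1 + y.2 = m := by simpa using hy
        subst hy
        rw [pow_add, dilate]
        push_cast
        ring
      rw [Finset.sum_congr rfl fun m _ => e m, Finset.sum_comm]
      refine Finset.sum_le_sum fun i _ => ?_
      refine (sum_range_antidiagonal_le (f := fun n => (dilate a i n : ℝ) * x ^ n)
        (g := fun n => (h (k - i) n : ℝ) * x ^ n) (fun n => by positivity) (fun n => by positivity) N).trans ?_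
      exact mul_le_mul (hq i) (ih _ (by omega)) (Finset.sum_nonneg fun n _ => by positivity) (hq0 i)

theorem IsTreeCount.ser_h_mem (hc : IsTreeCount Δ a t h) {x : ℝ} (hx : 0 ≤ x) (hx1 : x ≤ 1)
    (ha : ser a ∈ absSummable x) (i k : ℕ) :
    ser (dilate a i) ∈ absSummable x ∧ ser (h k) ∈ absSummable x := by
  have hd : ∀ i, ser (dilate a i) ∈ absSummable x := fun i =>
    ser_dilate_mem_absSummable i (absSummable_mono (by positivity) (pow_le_of_le_one hx hx1 (by omega)) ha)
  refine ⟨hd i, ?_⟩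
  induction k using Nat.strong_induction_on with
  | _ k ih =>
    cases k with
    | zero => have := hc.isComplete.zero; rw [this]; exact one_mem _
    | succ k =>
      have := hc.isComplete.succ_eq k
      rw [this]
      exact mul_mem (C_mem_absSummable _) (sum_mem fun i _ => mul_mem (hd i) (ih _ (by omega)))

theorem IsTreeCount.eval_isComplete (hc : IsTreeCount Δ a t h) {x : ℝ} (hx : 0 ≤ x) (hx1 : x ≤ 1)
    (ha : ser a ∈ absSummable x) :
    IsComplete (fun i => eval x (ser (dilate a i))) (fun k => eval x (ser (h k))) where
  zero := by have := hc.isComplete.zero; rw [this, eval_one]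
  succ k := by
    have hxn : ‖x‖ ≤ x := by rw [Real.norm_of_nonneg hx]
    have hm := hc.ser_h_mem hx hx1 ha
    have := congrArg (eval x) (hc.isComplete.succ k)
    have e : ((k : ℝ⟦X⟧) + 1) = C ((k : ℝ) + 1) := by simp
    rw [e, eval_mul (C_mem_absSummable _) (hm 0 _).2 hxn, eval_C,
      eval_sum _ (fun i _ => mul_mem (hm i 0).1 (hm 0 _).2) hxn] at this
    simp only [RCLike.ofReal_real_eq_id, id] at this
    rw [this]
    exact Finset.sum_congr rfl fun i _ => eval_mul (hm i 0).1 (hm 0 _).2 hxn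

theorem IsTreeCount.eval_eq (hc : IsTreeCount Δ a t h) {x : ℝ} (hx : 0 ≤ x) (hx1 : x ≤ 1)
    (ha : ser a ∈ absSummable x) :
    eval x (ser a) = x * ∑ k ∈ Finset.range Δ, eval x (ser (h k)) := by
  have hxn : ‖x‖ ≤ x := by rw [Real.norm_of_nonneg hx]
  have hm := fun k => (hc.ser_h_mem hx hx1 ha 0 k).2
  conv_lhs => rw [hc.ser_eq]
  rw [eval_mul X_mem_absSummable (sum_mem fun k _ => hm k) hxn, eval_X, eval_sum _ (fun k _ => hm k) hxn]

theorem IsTreeCount.quadratic_le (hΔ : 3 ≤ Δ) (hc : IsTreeCount Δ a t h) {x : ℝ} (hx : 0 ≤ x)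
    (hx1 : x ≤ 1) (ha : ser a ∈ absSummable x) :
    x * (1 + eval x (ser a) + eval x (ser a) ^ 2 / 2) ≤ eval x (ser a) := by
  have hC := hc.eval_isComplete hx hx1 ha
  have h0 := hC.zero
  have h1 := hC.succ 0
  have h2 := hC.succ 1
  simp [Finset.sum_range_succ, dilate_zero] at h0 h1 h2
  rw [h0, mul_one] at h1 h2
  have hn : ∀ u, 0 ≤ eval x (ser u) := fun u => eval_nonneg (coeff_ser_nonneg u) hx
  conv_rhs => rw [hc.eval_eq hx hx1 ha]
  gcongr
  have : ∑ k ∈ Finset.range 3, eval x (ser (h k)) ≤ ∑ k ∈ Finset.range Δ, eval x (ser (h k)) :=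
    Finset.sum_le_sum_of_subset_of_nonneg (Finset.range_mono hΔ) fun i _ _ => hn _
  refine le_trans ?_ this
  simp only [Finset.sum_range_succ, Finset.sum_range_zero]
  rw [h0, h1]
  rw [h1] at h2
  have := hn (dilate a 1)
  nlinarith

end

section
open PowerSeries
variable {Δ : ℕ} {a t : ℕ → ℕ} {h : ℕ → ℕ → ℕ}

theorem IsTreeCount.lt_half (hΔ : 3 ≤ Δ) (hc : IsTreeCount Δ a t h) {x : ℝ}
    (ha : ser a ∈ absSummable x) : x < 1 / 2 := by
  by_contra! hx
  have := hc.quadratic_le hΔ (x := 1 / 2) (by norm_num) (by norm_num)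
    (absSummable_mono (by norm_num) hx ha)
  nlinarith [sq_nonneg (eval (1 / 2 : ℝ) (ser a) - 1)]

theorem IsTreeCount.eval_le (hΔ : 3 ≤ Δ) (hc : IsTreeCount Δ a t h) {x : ℝ} (hx : 0 < x)
    (ha : ser a ∈ absSummable x) : eval x (ser a) ≤ 2 / x := by
  have h1 := hc.lt_half hΔ ha
  have h2 := hc.quadratic_le hΔ hx.le (by linarith) ha
  have h3 : 0 ≤ eval x (ser a) := eval_nonneg (coeff_ser_nonneg a) hx.le
  rw [le_div_iff₀ hx]
  by_contra! h4
  have h5 : 0 < eval x (ser a) := by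
    by_contra! h
    have : eval x (ser a) = 0 := le_antisymm h h3
    rw [this] at h4; linarith
  nlinarith

theorem IsTreeCount.exists_radius (hΔ : 3 ≤ Δ) (hc : IsTreeCount Δ a t h) :
    ∃ ρ : ℝ, 0 < ρ ∧ ρ < 1 / 2 ∧ ser a ∈ absSummable ρ ∧ ∀ x > ρ, ser a ∉ absSummable x := by
  set S := {x : ℝ | ser a ∈ absSummable x} with hS
  have h5 : (1 / 5 : ℝ) ∈ S := by
    change ser a ∈ absSummable _
    rw [mem_absSummable]
    refine Summable.of_nonneg_of_le (fun _ => norm_nonneg _) (fun n => ?_)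
      (summable_geometric_of_lt_one (r := 4 / 5) (by norm_num) (by norm_num))
    rw [coeff_ser, Real.norm_of_nonneg (by positivity)]
    have := hc.a_le n
    have : (a n : ℝ) ≤ 4 ^ n := by exact_mod_cast this
    calc (a n : ℝ) * (1 / 5) ^ n ≤ 4 ^ n * (1 / 5) ^ n := by gcongr
      _ = (4 / 5) ^ n := by rw [← mul_pow]; norm_num
  have hb : BddAbove S := ⟨1 / 2, fun x hx => (hc.lt_half hΔ hx).le⟩
  have hge : 1 / 5 ≤ sSup S := le_csSup hb h5
  have hmem : sSup S ∈ S := by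
    change ser a ∈ absSummable _
    rw [mem_absSummable]
    have hterm : ∀ n x, 0 ≤ x → ‖coeff n (ser a) * x ^ n‖ = coeff n (ser a) * x ^ n := fun n x hx =>
      Real.norm_of_nonneg (mul_nonneg (coeff_ser_nonneg a n) (by positivity))
    refine summable_of_sum_range_le (c := 10) (fun _ => norm_nonneg _) fun N => ?_
    rw [Finset.sum_congr rfl fun n _ => hterm n _ (by linarith)]
    by_contra! hlt
    have hcont : Continuous fun x : ℝ => ∑ n ∈ Finset.range N, coeff n (ser a) * x ^ n := by fun_prop
    obtain ⟨ε, hε, hball⟩ := Metric.eventually_nhds_iff.mp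
      ((hcont.tendsto (sSup S)).eventually_const_lt hlt)
    obtain ⟨x, hx, hxl⟩ := exists_lt_of_lt_csSup ⟨_, h5⟩ (by linarith : sSup S - ε < sSup S)
    have hxle := le_csSup hb hx
    have hy : max x (1 / 5) ∈ S := by rcases max_choice x (1 / 5 : ℝ) with h | h <;> rw [h]; exacts [hx, h5]
    have hyle : max x (1 / 5) ≤ sSup S := max_le hxle hge
    have hy5 : 1 / 5 ≤ max x (1 / 5) := le_max_right _ _
    have h1 := hball (y := max x (1 / 5)) (by
      rw [Real.dist_eq, abs_lt]
      constructor <;> linarith [le_max_left x (1 / 5 : ℝ)])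
    have h2 := hc.eval_le hΔ (by linarith : 0 < max x (1 / 5)) hy
    have h3 : ∑ n ∈ Finset.range N, coeff n (ser a) * (max x (1 / 5)) ^ n ≤
        eval (max x (1 / 5)) (ser a) := by
      have := hasSum_eval (𝕜 := ℝ) (z := max x (1 / 5)) hy
        (by rw [Real.norm_of_nonneg (by linarith)])
      exact sum_le_hasSum _ (fun n _ => mul_nonneg (coeff_ser_nonneg a n) (by positivity)) this
    have h4 : 2 / max x (1 / 5) ≤ 10 := by
      rw [div_le_iff₀ (by linarith)]; linarith
    linarith
  exact ⟨sSup S, by linarith, hc.lt_half hΔ hmem, hmem, fun x hx hxS => (le_csSup hb hxS).not_gt hx⟩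

/-- If the derivative of the characteristic system were less than `1` at `ρ`, the series would
converge beyond `ρ`. -/
theorem IsTreeCount.one_le_eval (hc : IsTreeCount Δ a t h) {ρ : ℝ} (hρ : 0 < ρ) (hρ1 : ρ < 1 / 2)
    (ha : ser a ∈ absSummable ρ) (hmax : ∀ x > ρ, ser a ∉ absSummable x) :
    1 ≤ ρ * ∑ k ∈ Finset.range Δ, shiftSeq (fun k => eval ρ (ser (h k))) k := by
  by_contra! hlt
  set p : ℝ → ℕ → ℝ := fun x i => eval x (ser (dilate a i)) with hp
  have hC := hc.eval_isComplete hρ.le (by linarith) ha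
  have hHc : ∀ k, eval ρ (ser (h k)) = complete (p ρ) k := hC.eq_complete
  set y0 := eval ρ (ser a) with hy0
  have hup : Function.update (p ρ) 0 y0 = p ρ := by
    rw [Function.update_eq_iff]
    exact ⟨by simp [hp, dilate_zero, hy0], fun _ _ => rfl⟩
  set F : ℝ → ℝ → ℝ := fun x y => x * ∑ k ∈ Finset.range Δ, complete (Function.update (p x) 0 y) k
    with hF
  have hF0 : F ρ y0 = y0 := by
    have := hc.eval_eq hρ.le (by linarith) ha
    simp only [hHc] at this
    simp only [hF, hup]
    exact this.symm
  have hder : HasDerivAt (F ρ)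
      (ρ * ∑ k ∈ Finset.range Δ, shiftSeq (fun k => eval ρ (ser (h k))) k) y0 := by
    have h1 := HasDerivAt.fun_sum (u := Finset.range Δ) (x := y0)
      fun k _ => hasDerivAt_complete (p ρ) y0 k
    have e : complete (p ρ) = fun k => eval ρ (ser (h k)) := funext fun k => (hHc k).symm
    rw [hup, e] at h1
    exact h1.const_mul ρ
  obtain ⟨y1, hy1, hy1F⟩ : ∃ y1 > y0, F ρ y1 < y1 := by
    have h2 := (hasDerivAt_iff_tendsto_slope.mp hder).eventually_lt_const hlt
    have h3 : ∀ᶠ y in 𝓝[>] y0, slope (F ρ) y0 y < 1 :=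
      h2.filter_mono (nhdsWithin_mono _ fun y hy => ne_of_gt hy)
    obtain ⟨y, hy, hys⟩ := (h3.and self_mem_nhdsWithin).exists
    refine ⟨y, hys, ?_⟩
    have hys' : 0 < y - y0 := sub_pos.mpr hys
    rw [slope_def_field, div_lt_one hys', hF0] at hy
    linarith
  set r := √ρ with hr
  have hr0 : 0 < r := Real.sqrt_pos.mpr hρ
  have hr2 : r ^ 2 = ρ := Real.sq_sqrt hρ.le
  have hr1 : r < 1 := by nlinarith
  have hρr : ρ < r := by nlinarith
  have hpm : ∀ i, i ≠ 0 → ser (dilate a i) ∈ absSummable r := by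
    intro i hi
    refine ser_dilate_mem_absSummable i (absSummable_mono (by positivity) ?_ ha)
    rw [← hr2]
    exact pow_le_pow_of_le_one hr0.le hr1.le (by omega)
  have hcont : ContinuousAt (fun x => F x y1) ρ := by
    refine continuousAt_id.mul (tendsto_finsetSum _ fun k _ => ?_)
    refine ((continuous_complete k).tendsto _).comp ?_
    rw [tendsto_pi_nhds]
    intro i
    by_cases hi : i = 0
    · subst hi; simp
    · simp only [Function.update_of_ne hi, hp]
      refine (continuousOn_eval (hpm i hi)).continuousAt (Metric.closedBall_mem_nhds_of_mem ?_)
      simpa [abs_of_pos hρ] using hρr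
  obtain ⟨x, ⟨hxF, hxr⟩, hxρ⟩ : ∃ x, (F x y1 < y1 ∧ x < r) ∧ ρ < x := by
    have h1 := (hcont.tendsto.eventually_lt_const hy1F).and (eventually_lt_nhds hρr)
    exact ((h1.filter_mono nhdsWithin_le_nhds).and self_mem_nhdsWithin : ∀ᶠ x in 𝓝[>] ρ, _).exists
  refine hmax x hxρ ?_
  have hx0 : 0 < x := hρ.trans hxρ
  have hy0' : 0 ≤ y0 := eval_nonneg (coeff_ser_nonneg a) hρ.le
  have hbound : ∀ N, ∑ n ∈ Finset.range N, (a n : ℝ) * x ^ n ≤ y1 := by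
    intro N
    induction N with
    | zero => simp; linarith
    | succ N ih =>
      have hq : ∀ i, ∑ n ∈ Finset.range N, (dilate a i n : ℝ) * x ^ n ≤
          Function.update (p x) 0 y1 i := by
        intro i
        by_cases hi : i = 0
        · subst hi; simpa [dilate_zero] using ih
        · rw [Function.update_of_ne hi]
          have hs : ser (dilate a i) ∈ absSummable x := absSummable_mono hx0.le hxr.le (hpm i hi)
          have := hasSum_eval (𝕜 := ℝ) (z := x) hs (by rw [Real.norm_of_nonneg hx0.le])
          refine sum_le_hasSum _ (fun n _ => by positivity) (this.congr_fun ?_ |> id)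
          intro n; simp [coeff_ser]
      rw [Finset.sum_range_succ']
      have e : ∀ n, (a (n + 1) : ℝ) * x ^ (n + 1) =
          x * ∑ k ∈ Finset.range Δ, (h k n : ℝ) * x ^ n := by
        intro n
        rw [hc.a_succ, ← Finset.sum_mul]; push_cast; ring
      rw [Finset.sum_congr rfl fun n _ => e n, ← Finset.mul_sum, Finset.sum_comm]
      simp only [hc.a_zero, Nat.cast_zero, zero_mul, add_zero]
      refine le_trans ?_ hxF.le
      simp only [hF]
      gcongr with k hk
      exact hc.sum_range_le_complete hx0.le hq k
  refine summable_of_sum_range_le (c := y1) (fun _ => norm_nonneg _) fun N => ?_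
  refine le_of_eq_of_le (Finset.sum_congr rfl fun n _ => ?_) (hbound N)
  rw [coeff_ser, Real.norm_of_nonneg (by positivity)]

/-- Otter's asymptotics, from the recurrences. -/
theorem IsTreeCount.tendsto (hΔ : 3 ≤ Δ) (hc : IsTreeCount Δ a t h) :
    ∃ τ x₀ : ℝ, 0 < τ ∧ 0 < x₀ ∧ x₀ ≤ 1 / 2 ∧
      Tendsto (fun n : ℕ => (t n : ℝ) * (n : ℝ) ^ ((5 : ℝ) / 2) * x₀ ^ n) atTop (𝓝 τ) := by
  obtain ⟨ρ, hρ, hρ2, ha, hmax⟩ := hc.exists_radius hΔ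
  have hcrit := hc.one_le_eval hρ hρ2 ha hmax
  obtain ⟨d, rfl⟩ : ∃ d, Δ = d + 3 := ⟨Δ - 3, by omega⟩
  have hρn : ‖ρ‖ ≤ ρ := by rw [Real.norm_of_nonneg hρ.le]
  have hHm := fun {x : ℝ} (hx : 0 ≤ x) (hx1 : x ≤ 1) hax k => (hc.ser_h_mem hx hx1 hax 0 k).2
  have hrad : ∀ i, (∀ n, 0 ≤ coeff n (ser (dilate a (i + 1)))) ∧
      ∃ r > ρ, ser (dilate a (i + 1)) ∈ absSummable r := by
    intro i
    have hr0 : 0 < √ρ := Real.sqrt_pos.mpr hρ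
    have hr2 : √ρ ^ 2 = ρ := Real.sq_sqrt hρ.le
    have hr1 : √ρ < 1 := by nlinarith
    refine ⟨coeff_ser_nonneg _, √ρ, by nlinarith, ser_dilate_mem_absSummable _
      (absSummable_mono (by positivity) ?_ ha)⟩
    calc √ρ ^ (i + 1 + 1) ≤ √ρ ^ 2 := pow_le_pow_of_le_one hr0.le hr1.le (by omega)
      _ = ρ := hr2
  obtain ⟨L, hL, B, hB, M, hM, u, hu, hTL, hTu, eL, e1, e2⟩ :=
    exists_euler_system (t := ser t) hρ.le ha (coeff_ser_nonneg a) hc.isComplete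
      (by rw [dilate_zero]) hrad hc.ser_eq hc.two_mul_ser
  set Q := X * ∑ k ∈ Finset.range (d + 2), ser (h k) with hQ
  set R := X * ∑ k ∈ Finset.range (d + 1), ser (h k) with hR
  have hsum : ∀ {x : ℝ}, 0 ≤ x → x ≤ 1 → ser a ∈ absSummable x → ∀ n,
      X * ∑ k ∈ Finset.range n, ser (h k) ∈ absSummable x := fun hx hx1 hax n =>
    mul_mem X_mem_absSummable (sum_mem fun k _ => hHm hx hx1 hax k)
  have hsum0 : ∀ n m, 0 ≤ coeff m (X * ∑ k ∈ Finset.range n, ser (h k)) := by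
    intro n m
    cases m with
    | zero => simp
    | succ m =>
      rw [coeff_succ_X_mul, map_sum]
      exact Finset.sum_nonneg fun k _ => coeff_ser_nonneg _ _
  have hsum1 : ∀ n, 1 ≤ coeff 1 (X * ∑ k ∈ Finset.range (n + 1), ser (h k)) := by
    intro n
    rw [show (1 : ℕ) = 0 + 1 from rfl, coeff_succ_X_mul, map_sum, Finset.sum_range_succ']
    have : coeff 0 (ser (h 0)) = 1 := by rw [coeff_ser, hc.h_zero]; simp
    rw [this]
    have := Finset.sum_nonneg fun k (_ : k ∈ Finset.range n) => coeff_ser_nonneg (h (k + 1)) 0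
    linarith
  have hpos : ∀ {f : ℝ⟦X⟧} {x : ℝ}, 0 < x → f ∈ absSummable x → (∀ n, 0 ≤ coeff n f) →
      1 ≤ coeff 1 f → 0 < eval x f := by
    intro f x hx hf h0 h1
    have := coeff_mul_pow_le_eval h0 hx.le hf 1
    nlinarith
  have ha1 : 1 ≤ coeff 1 (ser a) := by
    have := hsum1 (d + 2)
    rwa [← hc.ser_eq] at this
  have hL0 : ∀ n, 0 ≤ coeff n L := fun n => (coeff_ser_nonneg a n).trans (hTL n)
  have hQm := hsum hρ.le (by linarith) ha (d + 2)
  have hQ1 : eval ρ Q = 1 := by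
    refine le_antisymm ?_ ?_
    · by_contra! hgt
      have hcont : Tendsto (fun x => eval x Q) (𝓝[<] ρ) (𝓝 (eval ρ Q)) := by
        refine ((continuousOn_eval (𝕜 := ℝ) hQm) ρ (by simpa using hρn)).tendsto.mono_left
          (nhdsWithin_le_iff.mpr ?_)
        filter_upwards [Ioo_mem_nhdsLT hρ] with x hx
        simpa [abs_of_pos hx.1] using hx.2.le
      obtain ⟨x, hx1, hx2⟩ := ((hcont.eventually_const_lt hgt).and (Ioo_mem_nhdsLT hρ)).exists
      have hxn : ‖x‖ ≤ x := by rw [Real.norm_of_nonneg hx2.1.le]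
      have hax := absSummable_mono hx2.1.le hx2.2.le ha
      have hDm := euler_mem_absSummable ha hx2.1.le hx2.2
      have hQx := hsum hx2.1.le (by linarith [hx2.2]) hax (d + 2)
      have h1 := congrArg (eval x) eL
      rw [eval_mul hDm (sub_mem (one_mem _) hQx) hxn, eval_sub (one_mem _) hQx hxn, eval_one] at h1
      have h2 : 0 < eval x L := hpos hx2.1 (absSummable_mono hx2.1.le hx2.2.le hL) hL0
        (ha1.trans (hTL 1))
      have h3 : 0 ≤ eval x (euler (ser a)) := eval_nonneg (fun n => by
        rw [coeff_euler]; exact mul_nonneg (by positivity) (coeff_ser_nonneg a n)) hx2.1.le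
      nlinarith
    · rw [sum_range_shiftSeq] at hcrit
      rwa [hQ, eval_mul X_mem_absSummable (sum_mem fun k _ => hHm hρ.le (by linarith) ha k) hρn,
        eval_X, eval_sum _ (fun k _ => hHm hρ.le (by linarith) ha k) hρn]
  have ht : ser t ∈ absSummable ρ := by
    have e : ser t = C (1 / 2) * (2 * (X * ∑ k ∈ Finset.range (d + 3 + 1), ser (h k)) +
        ser (dilate a 1) - ser a ^ 2) := by
      rw [← hc.two_mul_ser, add_sub_cancel_right, ← mul_assoc]
      have : C (1 / 2 : ℝ) * 2 = 1 := by
        rw [← map_ofNat C 2, ← map_mul]; norm_num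
      rw [this, one_mul]
    rw [e]
    refine mul_mem (C_mem_absSummable _) (sub_mem (add_mem (mul_mem (ofNat_mem _ 2)
      (hsum hρ.le (by linarith) ha _)) (hc.ser_h_mem hρ.le (by linarith) ha 1 0).1) (pow_mem ha 2))
  obtain ⟨τ, hτ, hlim⟩ := tendsto_coeff_of_system hρ hQm hL hB hM hu
    (hsum hρ.le (by linarith) ha (d + 1)) ht (hsum0 _) (one_pos.trans_le (hsum1 _)) hQ1
    (hpos hρ hL hL0 (ha1.trans (hTL 1)))
    (hpos hρ hu (fun n => (coeff_ser_nonneg a n).trans (hTu n)) (ha1.trans (hTu 1)))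
    (hpos hρ (hsum hρ.le (by linarith) ha (d + 1)) (hsum0 _) (hsum1 _)) e1 e2
  exact ⟨τ, ρ, hτ, hρ, hρ2.le, by simpa only [coeff_ser] using hlim⟩

end

section Join

variable {V W U V' W' : Type}

/-- The disjoint union of two graphs together with an edge joining `u` and `w`. -/
def join (G : SimpleGraph V) (u : V) (H : SimpleGraph W) (w : W) : SimpleGraph (V ⊕ W) where
  Adj
    | .inl x, .inl y => G.Adj x y
    | .inl x, .inr y => x = u ∧ y = w
    | .inr x, .inl y => y = u ∧ x = w
    | .inr x, .inr y => H.Adj x y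
  symm := ⟨by rintro (x | x) (y | y) h <;> first | exact h.symm | exact h⟩
  loopless := ⟨by rintro (x | x) h <;> exact SimpleGraph.irrefl _ h⟩

variable (G : SimpleGraph V) (u : V) (H : SimpleGraph W) (w : W)

@[simp] theorem join_inl_inl {x y : V} :
    (join G u H w).Adj (.inl x) (.inl y) ↔ G.Adj x y := Iff.rfl

@[simp] theorem join_inl_inr {x : V} {y : W} :
    (join G u H w).Adj (.inl x) (.inr y) ↔ x = u ∧ y = w := Iff.rfl

@[simp] theorem join_inr_inl {x : W} {y : V} :
    (join G u H w).Adj (.inr x) (.inl y) ↔ y = u ∧ x = w := Iff.rfl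

@[simp] theorem join_inr_inr {x y : W} :
    (join G u H w).Adj (.inr x) (.inr y) ↔ H.Adj x y := Iff.rfl

/-- Isomorphism of rooted graphs. -/
def RIso (G : SimpleGraph V) (u : V) (H : SimpleGraph W) (w : W) : Prop :=
  ∃ e : G ≃g H, e u = w

theorem RIso.refl : RIso G u G u := ⟨SimpleGraph.Iso.refl, rfl⟩

variable {G u H w}

theorem RIso.symm (h : RIso G u H w) : RIso H w G u := by
  obtain ⟨e, rfl⟩ := h
  exact ⟨e.symm, by simp⟩

theorem RIso.trans {K : SimpleGraph U} {v : U} (h : RIso G u H w) (h' : RIso H w K v) :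
    RIso G u K v := by
  obtain ⟨e, rfl⟩ := h
  obtain ⟨f, rfl⟩ := h'
  exact ⟨e.trans f, rfl⟩

/-- Isomorphisms of the parts induce an isomorphism of joins. -/
def joinCongr {G' : SimpleGraph V'} {u' : V'} {H' : SimpleGraph W'} {w' : W'}
    (e : G ≃g G') (he : e u = u') (f : H ≃g H') (hf : f w = w') :
    join G u H w ≃g join G' u' H' w' where
  toEquiv := Equiv.sumCongr e.toEquiv f.toEquiv
  map_rel_iff' := by
    subst he hf
    rintro (x | x) (y | y)
    · exact e.map_rel_iff
    · simp
    · simp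
    · exact f.map_rel_iff

theorem RIso.join_congr {G' : SimpleGraph V'} {u' : V'} {H' : SimpleGraph W'} {w' : W'}
    (h : RIso G u G' u') (h' : RIso H w H' w') :
    RIso (join G u H w) (.inl u) (join G' u' H' w') (.inl u') := by
  obtain ⟨e, he⟩ := h
  obtain ⟨f, hf⟩ := h'
  exact ⟨joinCongr e he f hf, congrArg Sum.inl he⟩

variable (G u H w)

/-- Exchanging the two parts of a join. -/
def joinComm : join G u H w ≃g join H w G u where
  toEquiv := Equiv.sumComm V W
  map_rel_iff' := by rintro (x | x) (y | y) <;> simp [and_comm]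

/-- Two graphs attached to the same part of a join can be attached in either order. -/
def joinRightComm (x : V) (K : SimpleGraph U) (v : U) :
    join (join G u H w) (.inl x) K v ≃g join (join G x K v) (.inl u) H w where
  toFun
    | .inl (.inl z) => .inl (.inl z)
    | .inl (.inr z) => .inr z
    | .inr z => .inl (.inr z)
  invFun
    | .inl (.inl z) => .inl (.inl z)
    | .inl (.inr z) => .inr z
    | .inr z => .inl (.inr z)
  left_inv := by rintro ((z | z) | z) <;> rfl
  right_inv := by rintro ((z | z) | z) <;> rfl
  map_rel_iff' := by rintro ((z | z) | z) ((y | y) | y) <;> simp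

/-- Attaching a third graph to the second part of a join. -/
def joinAssoc (y : W) (K : SimpleGraph U) (v : U) :
    join (join G u H w) (.inr y) K v ≃g join G u (join H y K v) (.inl w) where
  toEquiv := Equiv.sumAssoc V W U
  map_rel_iff' := by rintro ((z | z) | z) ((y | y) | y) <;> simp

variable {G u H w}

theorem join_connected (hG : G.Connected) (hH : H.Connected) : (join G u H w).Connected := by
  have h1 : ∀ x, (join G u H w).Reachable (.inl u) (.inl x) := fun x =>
    (hG.preconnected u x).map (⟨Sum.inl, fun h => h⟩ : G →g join G u H w)
  have h2 : ∀ x, (join G u H w).Reachable (.inr w) (.inr x) := fun x =>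
    (hH.preconnected w x).map (⟨Sum.inr, fun h => h⟩ : H →g join G u H w)
  have h3 : (join G u H w).Adj (.inl u) (.inr w) := by simp
  have h4 : ∀ x, (join G u H w).Reachable (.inl u) x := by
    rintro (x | x)
    · exact h1 x
    · exact h3.reachable.trans (h2 x)
  have : Nonempty (V ⊕ W) := ⟨.inl u⟩
  exact ⟨fun x y => (h4 x).symm.trans (h4 y)⟩

theorem reachable_induction {G : SimpleGraph V} {u : V} (hG : G.Connected) {p : V → Prop} (hu : p u)
    (hp : ∀ x y, G.Adj x y → p x → p y) (x : V) : p x := by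
  obtain ⟨q⟩ := hG.preconnected u x
  induction q with
  | nil => exact hu
  | cons h q ih => exact ih (hp _ _ h hu)

theorem RIso.of_join {G' : SimpleGraph V'} {u' : V'} {H' : SimpleGraph W'} {w' : W'}
    (hG : G.Connected) (hH : H.Connected) (e : join G u H w ≃g join G' u' H' w')
    (hu : e (.inl u) = .inl u') (hw : e (.inr w) = .inr w') : RIso G u G' u' ∧ RIso H w H' w' := by
  have h1 : ∀ x, ∃ y, e (.inl x) = .inl y := by
    refine reachable_induction (p := fun x => ∃ y, e (.inl x) = .inl y) hG ⟨_, hu⟩ ?_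
    rintro x y hxy ⟨z, hz⟩
    rcases hy : e (.inl y) with t | t
    · exact ⟨t, rfl⟩
    · exfalso
      have h : (join G' u' H' w').Adj (e (.inl x)) (e (.inl y)) := e.map_rel_iff.2 hxy
      rw [hz, hy, join_inl_inr] at h
      rw [h.2, ← hw] at hy
      simpa using e.injective hy
  have h2 : ∀ x, ∃ y, e (.inr x) = .inr y := by
    refine reachable_induction (p := fun x => ∃ y, e (.inr x) = .inr y) hH ⟨_, hw⟩ ?_
    rintro x y hxy ⟨z, hz⟩
    rcases hy : e (.inr y) with t | t
    · exfalso
      have h : (join G' u' H' w').Adj (e (.inr x)) (e (.inr y)) := e.map_rel_iff.2 hxy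
      rw [hz, hy, join_inr_inl] at h
      rw [h.1, ← hu] at hy
      simpa using e.injective hy
    · exact ⟨t, rfl⟩
  choose f hf using h1
  choose g hg using h2
  constructor
  · refine ⟨⟨Equiv.ofBijective f ⟨fun x y h => ?_, fun y => ?_⟩, ?_⟩, ?_⟩
    · have : e (.inl x) = e (.inl y) := by rw [hf, hf, h]
      simpa using e.injective this
    · obtain ⟨x | x, hx⟩ := e.surjective (.inl y)
      · exact ⟨x, by simpa [hf] using hx⟩
      · simp [hg] at hx
    · intro x y
      have h : (join G' u' H' w').Adj (e (.inl x)) (e (.inl y)) ↔ _ := e.map_rel_iff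
      rwa [hf, hf] at h
    · exact Sum.inl_injective ((hf u).symm.trans hu)
  · refine ⟨⟨Equiv.ofBijective g ⟨fun x y h => ?_, fun y => ?_⟩, ?_⟩, ?_⟩
    · have : e (.inr x) = e (.inr y) := by rw [hg, hg, h]
      simpa using e.injective this
    · obtain ⟨x | x, hx⟩ := e.surjective (.inr y)
      · simp [hf] at hx
      · exact ⟨x, by simpa [hg] using hx⟩
    · intro x y
      have h : (join G' u' H' w').Adj (e (.inr x)) (e (.inr y)) ↔ _ := e.map_rel_iff
      rwa [hg, hg] at h
    · exact Sum.inr_injective ((hg w).symm.trans hw)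

/-- The degree of a vertex, as a cardinality. -/
noncomputable def deg (G : SimpleGraph V) (v : V) : ℕ := Nat.card {x // G.Adj v x}

theorem deg_iso (e : G ≃g H) (x : V) : deg H (e x) = deg G x :=
  (Nat.card_congr (e.toEquiv.subtypeEquiv fun _ => e.map_rel_iff.symm)).symm

open Classical in
theorem deg_join_inl [Finite V] [Finite W] (x : V) :
    deg (join G u H w) (.inl x) = deg G x + if x = u then 1 else 0 := by
  rw [deg, Nat.card_congr (Equiv.subtypeSum), Nat.card_sum]
  congr 1
  split_ifs with h
  · simp [h]
  · simp [h]

open Classical in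
theorem deg_join_inr [Finite V] [Finite W] (x : W) :
    deg (join G u H w) (.inr x) = deg H x + if x = w then 1 else 0 := by
  rw [← deg_iso (joinComm G u H w), ← deg_join_inl (u := w) (H := G) (w := u)]
  rfl

end Join

section Trees

/-- The vertices of the rooted tree described by `t`: `nil` is a single vertex, and
`node a b` attaches the root of `b` as a new child of the root of `a`. -/
def Vert : BinaryTree Unit → Type
  | .nil => Unit
  | .node _ a b => Vert a ⊕ Vert b

/-- The root of the rooted tree described by `t`. -/
def root : (t : BinaryTree Unit) → Vert t
  | .nil => ()
  | .node _ a _ => .inl (root a)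

/-- The rooted tree described by `t`, as a graph. -/
def graph : (t : BinaryTree Unit) → SimpleGraph (Vert t)
  | .nil => ⊥
  | .node _ a b => join (graph a) (root a) (graph b) (root b)

/-- The multiset of codes of the subtrees hanging from the root. -/
def kids : BinaryTree Unit → Multiset ℕ
  | .nil => 0
  | .node _ a b => Nat.pair (b.numNodes + 1) (Encodable.encode (kids b)) ::ₘ kids a

/-- A numerical code of the isomorphism class of a rooted tree. -/
def code (t : BinaryTree Unit) : ℕ := Nat.pair (t.numNodes + 1) (Encodable.encode (kids t))

/-- The order of the rooted tree with a given code. -/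
def wt (x : ℕ) : ℕ := x.unpair.1

theorem kids_nil : kids .nil = 0 := rfl

theorem kids_node (a b : BinaryTree Unit) : kids (.node () a b) = code b ::ₘ kids a := rfl

theorem kids_eq_zero {t : BinaryTree Unit} (h : kids t = 0) : t = .nil := by
  cases t with
  | nil => rfl
  | node _ a b => exact absurd h (Multiset.cons_ne_zero)

theorem wt_code (t : BinaryTree Unit) : wt (code t) = t.numNodes + 1 := by simp [wt, code]

theorem kids_eq_of_code_eq {a b : BinaryTree Unit} (h : code a = code b) : kids a = kids b := by
  rw [code, code, Nat.pair_eq_pair] at h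
  exact Encodable.encode_injective h.2

theorem sum_wt_kids (t : BinaryTree Unit) : ((kids t).map wt).sum = t.numNodes := by
  induction t with
  | nil => rfl
  | node _ a b iha ihb =>
    rw [kids_node, Multiset.map_cons, Multiset.sum_cons, iha, wt_code, BinaryTree.numNodes]
    omega

theorem numNodes_eq_of_kids_eq {a b : BinaryTree Unit} (h : kids a = kids b) :
    a.numNodes = b.numNodes := by rw [← sum_wt_kids, h, sum_wt_kids]

theorem code_eq_iff {a b : BinaryTree Unit} : code a = code b ↔ kids a = kids b :=
  ⟨kids_eq_of_code_eq, fun h => by rw [code, code, h, numNodes_eq_of_kids_eq h]⟩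

instance finite_vert (t : BinaryTree Unit) : Finite (Vert t) := by
  induction t with
  | nil => exact inferInstanceAs (Finite Unit)
  | node _ a b iha ihb => exact inferInstanceAs (Finite (Vert a ⊕ Vert b))

theorem card_vert (t : BinaryTree Unit) : Nat.card (Vert t) = t.numNodes + 1 := by
  induction t with
  | nil => exact Nat.card_unique (α := Unit)
  | node _ a b iha ihb =>
    rw [Vert, Nat.card_sum, iha, ihb, BinaryTree.numNodes]
    omega

theorem graph_connected (t : BinaryTree Unit) : (graph t).Connected := by
  induction t with
  | nil =>
    have : Nonempty (Vert .nil) := ⟨root _⟩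
    have : Subsingleton (Vert .nil) := inferInstanceAs (Subsingleton Unit)
    exact SimpleGraph.IsTree.of_subsingleton.connected
  | node _ a b iha ihb => exact join_connected iha ihb

theorem exists_node_of_mem_kids {t : BinaryTree Unit} {m : ℕ} (h : m ∈ kids t) :
    ∃ a b, code b = m ∧ kids t = m ::ₘ kids a ∧
      RIso (graph t) (root t) (graph (.node () a b)) (root (.node () a b)) := by
  induction t with
  | nil => simp [kids_nil] at h
  | node _ a' b' iha ihb =>
    rw [kids_node, Multiset.mem_cons] at h
    rcases h with rfl | h
    · exact ⟨a', b', rfl, rfl, RIso.refl _ _⟩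
    · obtain ⟨a, b, h1, h2, h3⟩ := iha h
      refine ⟨.node () a b', b, h1, ?_, ?_⟩
      · rw [kids_node, kids_node, h2, Multiset.cons_swap]
      · exact (RIso.join_congr h3 (RIso.refl _ _)).trans ⟨joinRightComm .., rfl⟩

theorem exists_node_of_adj_root {t : BinaryTree Unit} {w : Vert t} (h : (graph t).Adj (root t) w) :
    ∃ a b, kids t = kids (.node () a b) ∧
      ∃ e : graph t ≃g join (graph a) (root a) (graph b) (root b),
        e (root t) = .inl (root a) ∧ e w = .inr (root b) := by
  induction t with
  | nil => exact absurd h id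
  | node _ a' b' iha ihb =>
    rcases w with w | w
    · obtain ⟨a, b, h1, e, h2, h3⟩ := iha h
      refine ⟨.node () a b', b, ?_, (joinCongr e h2 SimpleGraph.Iso.refl rfl).trans
        (joinRightComm _ _ (graph b) (root b) _ (graph b') (root b')), ?_, ?_⟩
      · rw [kids_node, h1, kids_node, kids_node, kids_node, Multiset.cons_swap]
      · exact congrArg (fun x => joinRightComm (graph a) (root a) (graph b) (root b) (root a) (graph b')
          (root b') (.inl x)) h2
      · exact congrArg (fun x => joinRightComm (graph a) (root a) (graph b) (root b) (root a) (graph b')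
          (root b') (.inl x)) h3
    · obtain ⟨-, rfl⟩ := h
      exact ⟨a', b', rfl, SimpleGraph.Iso.refl, rfl, rfl⟩

theorem riso_of_kids_eq {t t' : BinaryTree Unit} (h : kids t = kids t') :
    RIso (graph t) (root t) (graph t') (root t') := by
  induction hn : t.numNodes using Nat.strong_induction_on generalizing t t' with
  | _ n ih =>
  subst hn
  cases t with
  | nil => rw [kids_eq_zero h.symm]; exact RIso.refl _ _
  | node _ a b =>
    obtain ⟨a', b', h1, h2, h3⟩ := exists_node_of_mem_kids (t := t') (m := code b)
      (by rw [← h, kids_node]; exact Multiset.mem_cons_self _ _)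
    rw [← h, kids_node, Multiset.cons_inj_right] at h2
    refine RIso.trans (RIso.join_congr ?_ ?_) h3.symm
    · exact ih _ (by simp [BinaryTree.numNodes]) h2 rfl
    · exact ih _ (by simp [BinaryTree.numNodes]) (kids_eq_of_code_eq h1.symm) rfl

theorem kids_eq_of_riso {t t' : BinaryTree Unit}
    (h : RIso (graph t) (root t) (graph t') (root t')) : kids t = kids t' := by
  induction hn : t.numNodes using Nat.strong_induction_on generalizing t t' with
  | _ n ih =>
  subst hn
  obtain ⟨e, he⟩ := h
  cases t with
  | nil =>
    have h1 := Nat.card_congr e.toEquiv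
    rw [card_vert, card_vert] at h1
    cases t' with
    | nil => rfl
    | node _ a b => simp [BinaryTree.numNodes] at h1
  | node _ a b =>
    have h1 : (graph t').Adj (root t') (e (.inr (root b))) := by
      rw [← he]
      exact e.map_rel_iff.2 ⟨rfl, rfl⟩
    obtain ⟨a', b', h2, f, h3, h4⟩ := exists_node_of_adj_root h1
    obtain ⟨ha, hb⟩ := RIso.of_join (G := graph a) (H := graph b) (u := root a) (w := root b)
      (graph_connected a) (graph_connected b) (e.trans f)
      ((congrArg f he).trans h3) h4
    rw [h2, kids_node, kids_node, ih _ (by simp [BinaryTree.numNodes]) ha rfl,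
      code_eq_iff.2 (ih _ (by simp [BinaryTree.numNodes]) hb rfl)]

theorem exists_pendant (t : BinaryTree Unit) (x : Vert t) :
    ∃ t', RIso (join (graph t) x (⊥ : SimpleGraph Unit) ()) (.inl (root t)) (graph t') (root t') := by
  induction t with
  | nil => exact ⟨.node () .nil .nil, RIso.refl _ _⟩
  | node _ a b iha ihb =>
    rcases x with x | x
    · obtain ⟨t', h⟩ := iha x
      refine ⟨.node () t' b, RIso.trans ⟨joinRightComm .., rfl⟩ (RIso.join_congr h (RIso.refl _ _))⟩
    · obtain ⟨t', h⟩ := ihb x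
      refine ⟨.node () a t', RIso.trans ⟨joinAssoc .., rfl⟩ (RIso.join_congr (RIso.refl _ _) h)⟩

theorem sum_deg_graph (t : BinaryTree Unit) : ∀ [Fintype (Vert t)],
    ∑ x, deg (graph t) x = 2 * t.numNodes := by
  classical
  induction t with
  | nil =>
    intro _
    refine Finset.sum_eq_zero fun x _ => ?_
    have : IsEmpty {y : Vert .nil // (graph .nil).Adj x y} := ⟨fun y => y.2⟩
    rw [deg, Nat.card_of_isEmpty]
  | node _ a b iha ihb =>
    have : Fintype (Vert a) := Fintype.ofFinite _
    have : Fintype (Vert b) := Fintype.ofFinite _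
    intro _
    have h : ∑ x, deg (graph (.node () a b)) x =
      ∑ x : Vert a ⊕ Vert b, deg (join (graph a) (root a) (graph b) (root b)) x := by
        refine Finset.sum_congr ?_ fun _ _ => rfl
        ext x
        exact ⟨fun _ => Finset.mem_univ (α := Vert a ⊕ Vert b) x, fun _ => Finset.mem_univ _⟩
    rw [h, Fintype.sum_sum_type]
    simp only [deg_join_inl, deg_join_inr, Finset.sum_add_distrib, iha, ihb, BinaryTree.numNodes]
    simp
    ring

theorem graph_isTree (t : BinaryTree Unit) : (graph t).IsTree := by
  classical
  have : Fintype (Vert t) := Fintype.ofFinite _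
  rw [SimpleGraph.isTree_iff_connected_and_card]
  refine ⟨graph_connected t, ?_⟩
  have h := (graph t).sum_degrees_eq_twice_card_edges
  have h2 : ∀ x, (graph t).degree x = deg (graph t) x := fun x => by
    rw [deg, ← SimpleGraph.card_neighborSet_eq_degree, ← Nat.card_eq_fintype_card]
    rfl
  simp only [h2, sum_deg_graph] at h
  rw [card_vert, Nat.card_eq_fintype_card, ← SimpleGraph.edgeFinset_card]
  omega

theorem exists_graph {V : Type} [Finite V] {G : SimpleGraph V} (hG : G.IsTree) (v : V) :
    ∃ t, RIso G v (graph t) (root t) := by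
  classical
  induction hn : Nat.card V using Nat.strong_induction_on generalizing V with
  | _ n ih =>
  subst hn
  have : Fintype V := Fintype.ofFinite _
  rcases subsingleton_or_nontrivial V with hV | hV
  · refine ⟨.nil, ⟨⟨⟨fun _ => (), fun _ => v, fun _ => Subsingleton.elim _ _, fun _ => rfl⟩, ?_⟩, rfl⟩⟩
    intro x y
    simp [Subsingleton.elim x y]
  · obtain ⟨z, hzv, hz⟩ : ∃ z, v ≠ z ∧ G.degree z = 1 := by
      obtain ⟨z, z', h, h1, h2⟩ := hG.exists_ne_and_degree_eq_one
      by_cases hv : v = z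
      · exact ⟨z', hv ▸ h, h2⟩
      · exact ⟨z, hv, h1⟩
    have hG' : (G.induce {z}ᶜ).IsTree :=
      ⟨hG.connected.induce_compl_singleton_of_degree_eq_one hz, hG.isAcyclic.induce _⟩
    obtain ⟨y, hzy, hy⟩ := SimpleGraph.degree_eq_one_iff_existsUnique_adj.1 hz
    have hyz : y ≠ z := fun h => G.irrefl (h ▸ hzy)
    have h1 : RIso (join (G.induce {z}ᶜ) ⟨y, hyz⟩ (⊥ : SimpleGraph Unit) ()) (.inl ⟨v, hzv⟩) G v := by
      refine ⟨⟨Equiv.ofBijective (Sum.elim (fun x => x.1) fun _ => z) ⟨?_, fun x => ?_⟩, ?_⟩, rfl⟩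
      · rintro (⟨x, hx⟩ | x) (⟨x', hx'⟩ | x') h
        · simpa using h
        · exact absurd h hx
        · exact absurd h.symm hx'
        · rfl
      · by_cases hx : x = z
        · exact ⟨.inr (), hx.symm⟩
        · exact ⟨.inl ⟨x, hx⟩, rfl⟩
      · rintro (⟨x, hx⟩ | x) (⟨x', hx'⟩ | x')
        · exact Iff.rfl
        · refine Iff.trans (b := x = y) ⟨fun h => hy _ h.symm, fun h => h ▸ hzy.symm⟩ ?_
          simp [Subtype.ext_iff]
        · refine Iff.trans (b := x' = y) ⟨fun h => hy _ h, fun h => h ▸ hzy⟩ ?_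
          simp [Subtype.ext_iff]
        · exact ⟨fun h => absurd h G.irrefl, fun h => absurd h id⟩
    obtain ⟨t, e, he⟩ := ih (Nat.card ↑({z}ᶜ : Set V)) (Finite.card_subtype_lt (x := z) (by simp)) hG' ⟨v, hzv⟩ rfl
    obtain ⟨t', ht'⟩ := exists_pendant t (e ⟨y, hyz⟩)
    refine ⟨t', h1.symm.trans (RIso.trans ⟨joinCongr e rfl SimpleGraph.Iso.refl rfl, ?_⟩ ht')⟩
    exact congrArg Sum.inl he

end Trees

section Degrees

/-- All degrees of the rooted tree `t` are at most `Δ`, even after attaching `e` further edges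
to its root. -/
def DegBdd (Δ : ℕ) (t : BinaryTree Unit) (e : ℕ) : Prop :=
  (∀ x, deg (graph t) x ≤ Δ) ∧ deg (graph t) (root t) + e ≤ Δ

variable {Δ : ℕ}

theorem degBdd_nil {e : ℕ} : DegBdd Δ .nil e ↔ e ≤ Δ := by
  have h : ∀ x, deg (graph .nil) x = 0 := fun x => by
    have : IsEmpty {y : Vert .nil // (graph .nil).Adj x y} := ⟨fun y => y.2⟩
    rw [deg, Nat.card_of_isEmpty]
  simp [DegBdd, h]

theorem degBdd_node {a b : BinaryTree Unit} {e : ℕ} :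
    DegBdd Δ (.node () a b) e ↔ DegBdd Δ a (e + 1) ∧ DegBdd Δ b 1 := by
  classical
  have h1 : ∀ x : Vert a, deg (graph (.node () a b)) (.inl x) =
      deg (graph a) x + if x = root a then 1 else 0 :=
    fun x => (deg_join_inl (G := graph a) (H := graph b) x).trans (by congr)
  have h2 : ∀ x : Vert b, deg (graph (.node () a b)) (.inr x) =
      deg (graph b) x + if x = root b then 1 else 0 :=
    fun x => (deg_join_inr (G := graph a) (H := graph b) x).trans (by congr)
  have h3 : deg (graph (.node () a b)) (root (.node () a b)) = deg (graph a) (root a) + 1 :=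
    (h1 (root a)).trans (by rw [if_pos rfl])
  rw [DegBdd, DegBdd, DegBdd, h3]
  constructor
  · rintro ⟨h, h'⟩
    refine ⟨⟨fun x => ?_, by omega⟩, fun x => ?_, ?_⟩
    · exact (Nat.le_add_right _ _).trans ((h1 x).symm.trans_le (h (.inl x)))
    · exact (Nat.le_add_right _ _).trans ((h2 x).symm.trans_le (h (.inr x)))
    · simpa using (h2 (root b)).symm.trans_le (h (.inr (root b)))
  · rintro ⟨⟨ha, ha'⟩, hb, hb'⟩
    refine ⟨?_, by omega⟩
    rintro (x | x)
    · refine (h1 x).trans_le ?_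
      split_ifs with hx
      · rw [hx]
        omega
      · exact ha x
    · refine (h2 x).trans_le ?_
      split_ifs with hx
      · rw [hx]
        exact hb'
      · exact hb x

theorem DegBdd.congr {a b : BinaryTree Unit} {e : ℕ} (h : kids a = kids b) (ha : DegBdd Δ a e) :
    DegBdd Δ b e := by
  obtain ⟨f, hf⟩ := riso_of_kids_eq h
  refine ⟨fun x => ?_, ?_⟩
  · obtain ⟨y, rfl⟩ := f.surjective x
    rw [deg_iso]
    exact ha.1 y
  · rw [← hf, deg_iso]
    exact ha.2

/-- `x` is the code of a tree that may hang below a vertex of a `Δ`-tree. -/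
def IsBranch (Δ x : ℕ) : Prop := ∃ b, code b = x ∧ DegBdd Δ b 1

theorem isBranch_code {b : BinaryTree Unit} : IsBranch Δ (code b) ↔ DegBdd Δ b 1 :=
  ⟨fun ⟨_, h, hb⟩ => hb.congr (kids_eq_of_code_eq h), fun h => ⟨b, rfl, h⟩⟩

theorem degBdd_iff {t : BinaryTree Unit} {e : ℕ} :
    DegBdd Δ t e ↔ (kids t).card + e ≤ Δ ∧ ∀ x ∈ kids t, IsBranch Δ x := by
  induction t generalizing e with
  | nil => simp [degBdd_nil, kids_nil]
  | node _ a b iha ihb =>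
    rw [degBdd_node, iha, kids_node, Multiset.card_cons, ← isBranch_code]
    simp only [Multiset.mem_cons, forall_eq_or_imp]
    rw [show (kids a).card + (e + 1) = (kids a).card + 1 + e by ring]
    tauto

theorem exists_kids {M : Multiset ℕ} (h : ∀ x ∈ M, IsBranch Δ x) : ∃ t, kids t = M := by
  induction M using Multiset.induction with
  | empty => exact ⟨.nil, rfl⟩
  | cons x M ih =>
    obtain ⟨a, rfl⟩ := ih fun y hy => h y (Multiset.mem_cons_of_mem hy)
    obtain ⟨b, rfl, -⟩ := h x (Multiset.mem_cons_self _ _)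
    exact ⟨.node () a b, rfl⟩

end Degrees

section Rerooting

/-- A linear order on codes that refines the comparison of orders. -/
def CodeLT (x y : ℕ) : Prop := wt x < wt y ∨ wt x = wt y ∧ x < y

/-- Moving the root across an edge towards the larger of the two parts. -/
def Step (M M' : Multiset ℕ) : Prop :=
  ∃ a b, M = kids (.node () a b) ∧ M' = kids (.node () b a) ∧ CodeLT (code a) (code b)

theorem CodeLT.le {a b : BinaryTree Unit} (h : CodeLT (code a) (code b)) :
    a.numNodes ≤ b.numNodes := by
  rw [CodeLT, wt_code, wt_code] at h
  omega

theorem numNodes_lt_of_mem_kids {a b : BinaryTree Unit} (h : code b ∈ kids a) :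
    b.numNodes < a.numNodes := by
  have := Multiset.single_le_sum (fun x _ => Nat.zero_le x) _ (Multiset.mem_map_of_mem wt h)
  rw [sum_wt_kids, wt_code] at this
  omega

theorem code_eq_or_mem {a b a' b' : BinaryTree Unit}
    (h : kids (.node () a b) = kids (.node () a' b')) :
    (code a = code a' ∧ code b = code b') ∨ (code b ∈ kids a' ∧ code b' ∈ kids a) := by
  rw [kids_node, kids_node, Multiset.cons_eq_cons] at h
  rcases h with ⟨h1, h2⟩ | ⟨-, M, h1, h2⟩
  · exact .inl ⟨code_eq_iff.2 h2, h1⟩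
  · exact .inr ⟨h2 ▸ Multiset.mem_cons_self _ _, h1 ▸ Multiset.mem_cons_self _ _⟩

theorem code_eq_of_codeLT {a b a' b' : BinaryTree Unit}
    (h : kids (.node () a b) = kids (.node () a' b')) (h1 : CodeLT (code a) (code b))
    (h2 : CodeLT (code a') (code b')) : code a = code a' ∧ code b = code b' := by
  rcases code_eq_or_mem h with h | ⟨h3, h4⟩
  · exact h
  · have := numNodes_lt_of_mem_kids h3
    have := numNodes_lt_of_mem_kids h4
    have := h1.le
    have := h2.le
    omega

theorem Step.unique {M M₁ M₂ : Multiset ℕ} (h₁ : Step M M₁) (h₂ : Step M M₂) : M₁ = M₂ := by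
  obtain ⟨a, b, rfl, rfl, h⟩ := h₁
  obtain ⟨a', b', h1, rfl, h'⟩ := h₂
  obtain ⟨ha, hb⟩ := code_eq_of_codeLT h1 h h'
  rw [kids_node, kids_node, ha, kids_eq_of_code_eq hb]

/-- A rooted tree whose root cannot be moved towards a larger part. -/
def IsTerminal (M : Multiset ℕ) : Prop := ∀ M', ¬ Step M M'

theorem exists_isTerminal (M : Multiset ℕ) : ∃ M', Relation.ReflTransGen Step M M' ∧ IsTerminal M' := by
  have key : ∀ k, ∀ a b : BinaryTree Unit, b.numNodes = k → CodeLT (code a) (code b) →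
      ∃ M', Relation.ReflTransGen Step (kids (.node () b a)) M' ∧ IsTerminal M' := by
    intro k
    induction k using Nat.strong_induction_on with
    | _ k ih =>
    rintro a b rfl hab
    by_cases ht : IsTerminal (kids (.node () b a))
    · exact ⟨_, .refl, ht⟩
    · simp only [IsTerminal, not_forall, not_not] at ht
      obtain ⟨M', a', b', h1, rfl, h2⟩ := ht
      obtain ⟨N, h3, h4⟩ := ih b'.numNodes (by
        rcases code_eq_or_mem h1 with ⟨h3, h4⟩ | ⟨-, h4⟩
        · rw [← h3, ← h4] at h2
          rw [CodeLT] at h2 hab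
          omega
        · exact numNodes_lt_of_mem_kids h4) a' b' rfl h2
      exact ⟨N, .head ⟨a', b', h1, rfl, h2⟩ h3, h4⟩
  by_cases ht : IsTerminal M
  · exact ⟨_, .refl, ht⟩
  · simp only [IsTerminal, not_forall, not_not] at ht
    obtain ⟨M', a, b, rfl, rfl, h⟩ := ht
    obtain ⟨N, h1, h2⟩ := key _ a b rfl h
    exact ⟨N, .head ⟨a, b, rfl, rfl, h⟩ h1, h2⟩

variable {V W : Type}

/-- `M` lists the codes of the subtrees of `G` hanging from `v`. -/
def HasKids (G : SimpleGraph V) (v : V) (M : Multiset ℕ) : Prop :=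
  ∃ t, kids t = M ∧ RIso G v (graph t) (root t)

theorem exists_hasKids [Finite V] {G : SimpleGraph V} (hG : G.IsTree) (v : V) :
    ∃ M, HasKids G v M := by
  obtain ⟨t, h⟩ := exists_graph hG v
  exact ⟨_, t, rfl, h⟩

theorem HasKids.unique {G : SimpleGraph V} {v : V} {M M' : Multiset ℕ} (h : HasKids G v M)
    (h' : HasKids G v M') : M = M' := by
  obtain ⟨t, rfl, h⟩ := h
  obtain ⟨t', rfl, h'⟩ := h'
  exact kids_eq_of_riso (h.symm.trans h')

theorem HasKids.map {G : SimpleGraph V} {v : V} {M : Multiset ℕ} (h : HasKids G v M)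
    {H : SimpleGraph W} (e : G ≃g H) : HasKids H (e v) M := by
  obtain ⟨t, rfl, h⟩ := h
  exact ⟨t, rfl, RIso.trans (RIso.symm ⟨e, rfl⟩) h⟩

theorem HasKids.nonempty_iso {G : SimpleGraph V} {v : V} {H : SimpleGraph W} {w : W}
    {M : Multiset ℕ} (h : HasKids G v M) (h' : HasKids H w M) : Nonempty (G ≃g H) := by
  obtain ⟨t, rfl, h⟩ := h
  obtain ⟨t', h1, h'⟩ := h'
  obtain ⟨e, -⟩ := h.trans ((riso_of_kids_eq h1.symm).trans h'.symm)
  exact ⟨e⟩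

theorem HasKids.step {G : SimpleGraph V} {v : V} {M M' : Multiset ℕ} (h : HasKids G v M)
    (hs : Step M M') : ∃ w, HasKids G w M' := by
  obtain ⟨t, rfl, h⟩ := h
  obtain ⟨a, b, h1, rfl, -⟩ := hs
  obtain ⟨e, -⟩ := h.trans (riso_of_kids_eq h1)
  exact ⟨e.symm (.inr (root b)), .node () b a, rfl,
    RIso.trans (RIso.symm ⟨e.symm, rfl⟩) ⟨joinComm _ _ _ _, rfl⟩⟩

theorem HasKids.reflTransGen {G : SimpleGraph V} {v : V} {M M' : Multiset ℕ} (h : HasKids G v M)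
    (hs : Relation.ReflTransGen Step M M') : ∃ w, HasKids G w M' := by
  induction hs with
  | refl => exact ⟨v, h⟩
  | tail _ hs ih =>
    obtain ⟨w, hw⟩ := ih
    exact hw.step hs

theorem HasKids.step_of_adj {G : SimpleGraph V} {v w : V} {M M' : Multiset ℕ}
    (h : HasKids G v M) (h' : HasKids G w M') (hvw : G.Adj v w) :
    Step M M' ∨ Step M' M ∨ M = M' := by
  obtain ⟨t, rfl, e, he⟩ := h
  have h1 : (graph t).Adj (root t) (e w) := he ▸ e.map_rel_iff.2 hvw
  obtain ⟨a, b, h2, f, h3, h4⟩ := exists_node_of_adj_root h1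
  have h5 : HasKids G w (kids (.node () b a)) := by
    refine ⟨_, rfl, RIso.trans ⟨(e.trans f).trans (joinComm _ _ _ _), ?_⟩ (RIso.refl _ _)⟩
    exact congrArg (joinComm (graph a) (root a) (graph b) (root b)) h4
  rw [h'.unique h5, h2]
  rcases lt_trichotomy (wt (code a)) (wt (code b)) with hw | hw | hw
  · exact .inl ⟨a, b, rfl, rfl, .inl hw⟩
  · rcases lt_trichotomy (code a) (code b) with hc | hc | hc
    · exact .inl ⟨a, b, rfl, rfl, .inr ⟨hw, hc⟩⟩
    · refine .inr (.inr ?_)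
      rw [kids_node, kids_node, hc, kids_eq_of_code_eq hc]
    · exact .inr (.inl ⟨b, a, rfl, rfl, .inr ⟨hw.symm, hc⟩⟩)
  · exact .inr (.inl ⟨b, a, rfl, rfl, .inl hw⟩)

theorem HasKids.eq_of_isTerminal [Finite V] {G : SimpleGraph V} (hG : G.IsTree) {v w : V}
    {M M' : Multiset ℕ} (h : HasKids G v M) (h' : HasKids G w M') (hM : IsTerminal M)
    (hM' : IsTerminal M') : M = M' := by
  have heq : Equivalence (Relation.Join (Relation.ReflTransGen Step)) :=
    Relation.equivalence_join_reflTransGen fun a b c h1 h2 =>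
      ⟨b, .refl, h1.unique h2 ▸ .refl⟩
  have hterm : ∀ {N N'}, IsTerminal N → Relation.ReflTransGen Step N N' → N' = N := by
    intro N N' hN hs
    rcases hs.cases_head with h | ⟨_, h, -⟩
    · exact h.symm
    · exact absurd h (hN _)
  have key : ∀ w, ∀ M', HasKids G w M' → Relation.Join (Relation.ReflTransGen Step) M M' := by
    refine reachable_induction (u := v) hG.connected ?_ ?_
    · intro M' h'
      rw [h.unique h']
      exact heq.refl _
    · intro x y hxy ih M' h'
      obtain ⟨N, hN⟩ := exists_hasKids hG x
      refine heq.trans (ih N hN) ?_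
      rcases hN.step_of_adj h' hxy with h | h | rfl
      · exact ⟨M', .single h, .refl⟩
      · exact ⟨N, .refl, .single h⟩
      · exact heq.refl _
  obtain ⟨N, h1, h2⟩ := key w M' h'
  rw [← hterm hM h1, ← hterm hM' h2]

end Rerooting

section Counting

variable (Δ : ℕ)

open Classical in
/-- The codes of branches of order `n`. -/
noncomputable def branches (n : ℕ) : Finset ℕ :=
  ((BinaryTree.treesOfNumNodesEq (n - 1)).image code).filter fun x => IsBranch Δ x ∧ wt x = n

open Classical in
/-- The multisets of `k` branches of total order `m`. -/
noncomputable def forests (k m : ℕ) : Finset (Multiset ℕ) :=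
  ((BinaryTree.treesOfNumNodesEq m).image kids).filter fun M =>
    M.card = k ∧ ∀ x ∈ M, IsBranch Δ x

variable {Δ}

theorem mem_branches {n x : ℕ} : x ∈ branches Δ n ↔ IsBranch Δ x ∧ wt x = n := by
  classical
  rw [branches, Finset.mem_filter, Finset.mem_image, and_iff_right_iff_imp]
  rintro ⟨⟨b, rfl, -⟩, h⟩
  rw [wt_code] at h
  exact ⟨b, by simp [← h], rfl⟩

theorem mem_forests {k m : ℕ} {M : Multiset ℕ} :
    M ∈ forests Δ k m ↔ M.card = k ∧ (∀ x ∈ M, IsBranch Δ x) ∧ (M.map wt).sum = m := by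
  classical
  rw [forests, Finset.mem_filter, Finset.mem_image]
  constructor
  · rintro ⟨⟨t, h, rfl⟩, h1, h2⟩
    rw [BinaryTree.mem_treesOfNumNodesEq] at h
    exact ⟨h1, h2, by rw [sum_wt_kids, h]⟩
  · rintro ⟨h1, h2, h3⟩
    obtain ⟨t, rfl⟩ := exists_kids h2
    rw [sum_wt_kids] at h3
    exact ⟨⟨t, by simp [h3], rfl⟩, h1, h2⟩

theorem card_branches_zero : (branches Δ 0).card = 0 := by
  rw [Finset.card_eq_zero, Finset.eq_empty_iff_forall_notMem]
  intro x hx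
  obtain ⟨⟨b, rfl, -⟩, h⟩ := mem_branches.1 hx
  rw [wt_code] at h
  omega

theorem card_branches_le (n : ℕ) : (branches Δ n).card ≤ 4 ^ n := by
  classical
  calc (branches Δ n).card ≤ ((BinaryTree.treesOfNumNodesEq (n - 1)).image code).card :=
        Finset.card_filter_le _ _
    _ ≤ (BinaryTree.treesOfNumNodesEq (n - 1)).card := Finset.card_image_le
    _ = (n - 1).centralBinom / (n - 1 + 1) := by
        rw [BinaryTree.treesOfNumNodesEq_card_eq_catalan, catalan_eq_centralBinom_div]
    _ ≤ (n - 1).centralBinom := Nat.div_le_self _ _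
    _ ≤ 4 ^ (n - 1) := by
        rw [Nat.centralBinom, show (4 : ℕ) ^ (n - 1) = 2 ^ (2 * (n - 1)) by rw [pow_mul]; norm_num]
        exact Nat.choose_le_two_pow _ _
    _ ≤ 4 ^ n := Nat.pow_le_pow_right (by norm_num) (Nat.sub_le _ _)

theorem card_forests_zero (m : ℕ) : (forests Δ 0 m).card = if m = 0 then 1 else 0 := by
  split_ifs with h
  · rw [Finset.card_eq_one]
    refine ⟨0, Finset.ext fun M => ?_⟩
    rw [mem_forests, Finset.mem_singleton, Multiset.card_eq_zero, and_iff_left_iff_imp]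
    rintro rfl
    simp [h]
  · rw [Finset.card_eq_zero, Finset.eq_empty_iff_forall_notMem]
    intro M hM
    rw [mem_forests, Multiset.card_eq_zero] at hM
    obtain ⟨rfl, -, h1⟩ := hM
    exact h (by simpa using h1.symm)

theorem card_biUnion_forests (d m : ℕ) :
    ((Finset.range d).biUnion fun k => forests Δ k m).card =
      ∑ k ∈ Finset.range d, (forests Δ k m).card := by
  refine Finset.card_biUnion fun i _ j _ hij => Finset.disjoint_left.2 fun M h1 h2 => hij ?_
  rw [← (mem_forests.1 h1).1, (mem_forests.1 h2).1]

theorem card_branches_succ (m : ℕ) :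
    (branches Δ (m + 1)).card = ∑ k ∈ Finset.range Δ, (forests Δ k m).card := by
  rw [← card_biUnion_forests, ← Finset.card_image_of_injective _
    (f := fun M : Multiset ℕ => Nat.pair (m + 1) (Encodable.encode M))]
  · congr 1
    ext x
    simp only [mem_branches, Finset.mem_image, Finset.mem_biUnion, Finset.mem_range, mem_forests]
    constructor
    · rintro ⟨⟨b, rfl, hb⟩, h⟩
      rw [wt_code, Nat.add_right_cancel_iff] at h
      rw [degBdd_iff] at hb
      exact ⟨kids b, ⟨_, hb.1, rfl, hb.2, by rw [sum_wt_kids, h]⟩, by rw [code, h]⟩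
    · rintro ⟨M, ⟨k, hk, rfl, h1, h2⟩, rfl⟩
      obtain ⟨t, rfl⟩ := exists_kids h1
      rw [sum_wt_kids] at h2
      subst h2
      refine ⟨?_, wt_code t⟩
      exact isBranch_code.2 (degBdd_iff.2 ⟨hk, h1⟩)
  · intro M N h
    exact Encodable.encode_injective (Nat.pair_eq_pair.1 h).2

theorem card_forests_newton_aux (k m i : ℕ) (hi : i < k + 1) :
    ∑ M ∈ forests Δ (k + 1) m, (M.toFinset.filter fun x => i < M.count x).card =
      ∑ p ∈ Finset.HasAntidiagonal.antidiagonal m,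
        (if i + 1 ∣ p.1 then (branches Δ (p.1 / (i + 1))).card else 0) *
          (forests Δ (k - i) p.2).card := by
  have h : ∀ p ∈ Finset.HasAntidiagonal.antidiagonal m,
      (if i + 1 ∣ p.1 then (branches Δ (p.1 / (i + 1))).card else 0) *
          (forests Δ (k - i) p.2).card =
      ((if i + 1 ∣ p.1 then branches Δ (p.1 / (i + 1)) else ∅) ×ˢ forests Δ (k - i) p.2).card := by
    intro p _
    rw [Finset.card_product]
    split_ifs <;> simp
  rw [Finset.sum_congr rfl h, ← Finset.card_sigma, ← Finset.card_sigma]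
  refine Finset.card_nbij'
    (fun q => ⟨((i + 1) * wt q.2, m - (i + 1) * wt q.2), q.2, q.1 - Multiset.replicate (i + 1) q.2⟩)
    (fun q => ⟨q.2.2 + Multiset.replicate (i + 1) q.2.1, q.2.1⟩) ?_ ?_ ?_ ?_
  · rintro ⟨M, x⟩ hq
    simp only [Finset.coe_sigma, Set.mem_sigma_iff, Finset.mem_coe, mem_forests, Finset.mem_filter,
      Multiset.mem_toFinset] at hq
    obtain ⟨⟨h1, h2, h3⟩, hx, hc⟩ := hq
    have hc' : Multiset.replicate (i + 1) x ≤ M := Multiset.le_count_iff_replicate_le.1 hc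
    obtain ⟨N, rfl⟩ := Multiset.le_iff_exists_add.1 hc'
    rw [Multiset.card_add, Multiset.card_replicate] at h1
    rw [Multiset.map_add, Multiset.sum_add, Multiset.map_replicate, Multiset.sum_replicate,
      smul_eq_mul] at h3
    have hd : (i + 1) * wt x / (i + 1) = wt x := Nat.mul_div_cancel_left _ (Nat.succ_pos i)
    simp only [Finset.coe_sigma, Set.mem_sigma_iff, Finset.mem_coe, mem_forests,
      Finset.mem_product, dvd_mul_right, if_true, hd, mem_branches, add_tsub_cancel_left]
    refine ⟨by simp; omega, ⟨h2 x hx, trivial⟩, by omega, fun y hy => h2 y ?_, by omega⟩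
    exact Multiset.mem_add.2 (.inr hy)
  · rintro ⟨p, x, N⟩ hq
    simp only [Finset.coe_sigma, Set.mem_sigma_iff, Finset.mem_coe, mem_forests,
      Finset.mem_product] at hq
    obtain ⟨hp, hx, h1, h2, h3⟩ := hq
    split_ifs at hx with hd
    · rw [mem_branches] at hx
      obtain ⟨c, hc⟩ := hd
      rw [hc, Nat.mul_div_cancel_left _ (Nat.succ_pos i)] at hx
      have hp' : p.1 + p.2 = m := by simpa using hp
      simp only [Finset.coe_sigma, Set.mem_sigma_iff, Finset.mem_coe, mem_forests,
        Finset.mem_filter, Multiset.mem_toFinset]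
      refine ⟨⟨?_, ?_, ?_⟩, ?_, ?_⟩
      · rw [Multiset.card_add, Multiset.card_replicate]
        omega
      · intro y hy
        rcases Multiset.mem_add.1 hy with hy | hy
        · exact h2 y hy
        · rw [Multiset.eq_of_mem_replicate hy]
          exact hx.1
      · rw [Multiset.map_add, Multiset.sum_add, Multiset.map_replicate, Multiset.sum_replicate,
          smul_eq_mul, h3, hx.2, ← hc]
        omega
      · simp
      · rw [Multiset.count_add, Multiset.count_replicate_self]
        omega
    · simp at hx
  · rintro ⟨M, x⟩ hq
    simp only [Finset.coe_sigma, Set.mem_sigma_iff, Finset.mem_coe, Finset.mem_filter] at hq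
    have := tsub_add_cancel_of_le (Multiset.le_count_iff_replicate_le.1 hq.2.2)
    simpa using this
  · rintro ⟨p, x, N⟩ hq
    simp only [Finset.coe_sigma, Set.mem_sigma_iff, Finset.mem_coe,
      Finset.mem_product] at hq
    obtain ⟨hp, hx, -⟩ := hq
    split_ifs at hx with hd
    · rw [mem_branches] at hx
      obtain ⟨c, hc⟩ := hd
      rw [hc, Nat.mul_div_cancel_left _ (Nat.succ_pos i)] at hx
      have hp' : p.1 + p.2 = m := by simpa using hp
      have h1 : (i + 1) * wt x = p.1 := by rw [hx.2, hc]
      have h2 : m - (i + 1) * wt x = p.2 := by omega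
      simp only [h1, add_tsub_cancel_right]
      rw [h1] at h2
      rw [h2]
    · simp at hx

theorem card_forests_newton (k m : ℕ) : (k + 1) * (forests Δ (k + 1) m).card =
    ∑ i ∈ Finset.range (k + 1), ∑ p ∈ Finset.HasAntidiagonal.antidiagonal m,
      (if i + 1 ∣ p.1 then (branches Δ (p.1 / (i + 1))).card else 0) *
        (forests Δ (k - i) p.2).card := by
  rw [← Finset.sum_congr rfl fun i hi => card_forests_newton_aux k m i (Finset.mem_range.1 hi),
    Finset.sum_comm, mul_comm, ← smul_eq_mul, ← Finset.sum_const]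
  refine Finset.sum_congr rfl fun M hM => ?_
  have hM := (mem_forests.1 hM).1
  simp only [Finset.card_filter]
  rw [Finset.sum_comm, ← hM, ← Multiset.toFinset_sum_count_eq]
  refine Finset.sum_congr rfl fun x _ => ?_
  rw [← Finset.card_filter]
  have h : M.count x ≤ ∑ a ∈ M.toFinset, M.count a := by
    rw [Multiset.toFinset_sum_count_eq]; exact Multiset.count_le_card _ _
  rw [show (Finset.range (∑ a ∈ M.toFinset, M.count a)).filter (fun i => i < M.count x) =
    Finset.range (M.count x) by ext i; simp only [Finset.mem_filter, Finset.mem_range]; omega,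
    Finset.card_range]

end Counting

section Dissimilarity

variable (Δ : ℕ)

/-- The rooted `Δ`-trees of order `m + 1`. -/
noncomputable def rootedTrees (m : ℕ) : Finset (Multiset ℕ) :=
  (Finset.range (Δ + 1)).biUnion fun k => forests Δ k m

open Classical in
/-- The pairs of branches of total order `n`. -/
noncomputable def branchPairs (n : ℕ) : Finset (ℕ × ℕ) :=
  (((Finset.range (n + 1)).biUnion (branches Δ)) ×ˢ
    ((Finset.range (n + 1)).biUnion (branches Δ))).filter fun p => wt p.1 + wt p.2 = n

variable {Δ}

theorem mem_rootedTrees {m : ℕ} {t : BinaryTree Unit} :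
    kids t ∈ rootedTrees Δ m ↔ DegBdd Δ t 0 ∧ t.numNodes = m := by
  simp only [rootedTrees, Finset.mem_biUnion, Finset.mem_range, mem_forests, degBdd_iff,
    sum_wt_kids]
  constructor
  · rintro ⟨k, hk, rfl, h1, h2⟩
    exact ⟨⟨by omega, h1⟩, h2⟩
  · rintro ⟨⟨h, h1⟩, h2⟩
    exact ⟨_, by omega, rfl, h1, h2⟩

theorem exists_kids_of_mem_rootedTrees {m : ℕ} {M : Multiset ℕ} (h : M ∈ rootedTrees Δ m) :
    ∃ t, kids t = M := by
  simp only [rootedTrees, Finset.mem_biUnion, mem_forests] at h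
  obtain ⟨-, -, -, h, -⟩ := h
  exact exists_kids h

theorem HasKids.mem_rootedTrees {m : ℕ} (G : DTree Δ (m + 1)) {v : Fin (m + 1)} {M : Multiset ℕ}
    (h : HasKids G.1 v M) : M ∈ rootedTrees Δ m := by
  obtain ⟨t, rfl, e, he⟩ := h
  have hd : ∀ x, deg (graph t) x ≤ Δ := fun x => by
    obtain ⟨y, rfl⟩ := e.surjective x
    rw [deg_iso]
    exact G.2.2 y
  rw [TreePaper.mem_rootedTrees]
  refine ⟨⟨hd, hd _⟩, ?_⟩
  have := Nat.card_congr e.toEquiv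
  rw [card_vert, Nat.card_eq_fintype_card, Fintype.card_fin] at this
  omega

theorem exists_dTree {m : ℕ} {M : Multiset ℕ} (h : M ∈ rootedTrees Δ m) :
    ∃ (G : DTree Δ (m + 1)) (v : Fin (m + 1)), HasKids G.1 v M := by
  obtain ⟨t, rfl⟩ := exists_kids_of_mem_rootedTrees h
  rw [mem_rootedTrees] at h
  have e : Vert t ≃ Fin (m + 1) := Finite.equivFinOfCardEq (by rw [card_vert, h.2])
  have f : graph t ≃g (graph t).map e.toEmbedding := SimpleGraph.Iso.map e (graph t)
  refine ⟨⟨(graph t).map e.toEmbedding, f.isTree_iff.1 (graph_isTree t), fun v => ?_⟩,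
    f (root t), t, rfl, RIso.symm ⟨f, rfl⟩⟩
  obtain ⟨y, rfl⟩ := f.surjective v
  exact (deg_iso f y).trans_le (h.1.1 y)

open Classical in
theorem tTotal_succ (m : ℕ) :
    tTotal Δ (m + 1) = ((rootedTrees Δ m).filter IsTerminal).card := by
  have h1 : ∀ G : DTree Δ (m + 1), ∃ M : {M // M ∈ (rootedTrees Δ m).filter IsTerminal},
      ∃ v, HasKids G.1 v M := by
    intro G
    obtain ⟨M, hM⟩ := exists_hasKids G.2.1 0
    obtain ⟨M', h1, h2⟩ := exists_isTerminal M
    obtain ⟨w, hw⟩ := hM.reflTransGen h1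
    exact ⟨⟨M', Finset.mem_filter.2 ⟨hw.mem_rootedTrees, h2⟩⟩, w, hw⟩
  choose F v hF using h1
  rw [tTotal, ← Fintype.card_coe, ← Nat.card_eq_fintype_card]
  refine Nat.card_eq_of_bijective (fun c : TClass Δ (m + 1) => F c.out) ⟨fun c c' h => ?_, ?_⟩
  · refine Quotient.out_equiv_out.1 ?_
    have h2 := hF c'.out
    rw [← show F c.out = F c'.out from h] at h2
    exact (hF c.out).nonempty_iso h2
  · rintro ⟨M, hM⟩
    rw [Finset.mem_filter] at hM
    obtain ⟨G, w, hG⟩ := exists_dTree hM.1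
    obtain ⟨e⟩ := Quotient.mk_out (s := treeSetoid Δ (m + 1)) G
    refine ⟨Quotient.mk _ G, Subtype.ext ?_⟩
    exact ((hF _).map e).eq_of_isTerminal G.2.1 hG (Finset.mem_filter.1 (F _).2).2 hM.2

theorem tTotal_zero : tTotal Δ 0 = 0 := by
  have : IsEmpty (TClass Δ 0) := ⟨fun c => (c.out.2.1.connected.nonempty.some).elim0⟩
  rw [tTotal, Nat.card_of_isEmpty]

theorem mem_branchPairs {n : ℕ} {p : ℕ × ℕ} : p ∈ branchPairs Δ n ↔
    IsBranch Δ p.1 ∧ IsBranch Δ p.2 ∧ wt p.1 + wt p.2 = n := by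
  classical
  simp only [branchPairs, Finset.mem_filter, Finset.mem_product, Finset.mem_biUnion,
    Finset.mem_range, mem_branches]
  constructor
  · rintro ⟨⟨⟨_, -, h1, -⟩, ⟨_, -, h2, -⟩⟩, h3⟩
    exact ⟨h1, h2, h3⟩
  · rintro ⟨h1, h2, h3⟩
    exact ⟨⟨⟨_, by omega, h1, rfl⟩, ⟨_, by omega, h2, rfl⟩⟩, h3⟩

theorem card_branchPairs (n : ℕ) : (branchPairs Δ n).card =
    ∑ x ∈ Finset.HasAntidiagonal.antidiagonal n, (branches Δ x.1).card * (branches Δ x.2).card := by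
  classical
  rw [Finset.card_eq_sum_card_fiberwise (f := fun p => (wt p.1, wt p.2))
    (t := Finset.HasAntidiagonal.antidiagonal n)]
  · refine Finset.sum_congr rfl fun q hq => ?_
    have hq' : q.1 + q.2 = n := by simpa using hq
    rw [← Finset.card_product]
    congr 1
    ext p
    simp only [Finset.mem_filter, Finset.mem_product, mem_branches, mem_branchPairs, Prod.ext_iff]
    constructor
    · rintro ⟨⟨h1, h2, -⟩, h3, h4⟩
      exact ⟨⟨h1, h3⟩, h2, h4⟩
    · rintro ⟨⟨h1, h3⟩, h2, h4⟩
      exact ⟨⟨h1, h2, by omega⟩, h3, h4⟩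
  · intro p hp
    simpa using (mem_branchPairs.1 hp).2.2

open Classical in
theorem card_branchPairs_eq (n : ℕ) : (branchPairs Δ n).card =
    2 * ((branchPairs Δ n).filter fun p => CodeLT p.1 p.2).card +
      if 2 ∣ n then (branches Δ (n / 2)).card else 0 := by
  have h1 : ((branchPairs Δ n).filter fun p => ¬ CodeLT p.1 p.2 ∧ p.1 ≠ p.2).card =
      ((branchPairs Δ n).filter fun p => CodeLT p.1 p.2).card := by
    refine Finset.card_nbij' Prod.swap Prod.swap ?_ ?_ (fun _ _ => rfl) (fun _ _ => rfl)
    · rintro ⟨x, y⟩ h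
      simp only [Finset.mem_coe, Finset.mem_filter, mem_branchPairs, Prod.swap] at h ⊢
      rw [CodeLT] at h ⊢
      obtain ⟨⟨h1, h2, h3⟩, h4, h5⟩ := h
      exact ⟨⟨h2, h1, by omega⟩, by omega⟩
    · rintro ⟨x, y⟩ h
      simp only [Finset.mem_coe, Finset.mem_filter, mem_branchPairs, Prod.swap] at h ⊢
      rw [CodeLT] at h ⊢
      obtain ⟨⟨h1, h2, h3⟩, h4⟩ := h
      exact ⟨⟨h2, h1, by omega⟩, by omega, by rintro rfl; omega⟩
  have h2 : ((branchPairs Δ n).filter fun p => ¬ CodeLT p.1 p.2 ∧ ¬ p.1 ≠ p.2).card =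
      if 2 ∣ n then (branches Δ (n / 2)).card else 0 := by
    split_ifs with hn
    · refine Finset.card_nbij' Prod.fst (fun x => (x, x)) ?_ ?_ ?_ ?_
      · rintro ⟨x, y⟩ h
        simp only [Finset.mem_coe, Finset.mem_filter, mem_branchPairs, not_not,
          mem_branches] at h ⊢
        obtain ⟨⟨h1, h2, h3⟩, h4, rfl⟩ := h
        exact ⟨h1, by omega⟩
      · intro x h
        simp only [Finset.mem_coe, Finset.mem_filter, mem_branchPairs, not_not,
          mem_branches, CodeLT] at h ⊢
        exact ⟨⟨h.1, h.1, by omega⟩, by omega, trivial⟩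
      · rintro ⟨x, y⟩ h
        simp only [Finset.mem_coe, Finset.mem_filter, not_not] at h
        rw [h.2.2]
      · intro x _
        rfl
    · rw [Finset.card_eq_zero, Finset.filter_eq_empty_iff]
      rintro ⟨x, y⟩ h ⟨-, h'⟩
      obtain ⟨-, -, h3⟩ := mem_branchPairs.1 h
      simp only [not_not] at h'
      subst h'
      exact hn ⟨wt x, by simp only at h3; omega⟩
  rw [← Finset.card_filter_add_card_filter_not (s := branchPairs Δ n) fun p => CodeLT p.1 p.2,
    ← Finset.card_filter_add_card_filter_not
      (s := (branchPairs Δ n).filter fun p => ¬ CodeLT p.1 p.2) fun p => p.1 ≠ p.2,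
    Finset.filter_filter, Finset.filter_filter, h1, h2]
  ring

/-- The multiset of subtrees of the tree with a given code. -/
def kidsOfCode (x : ℕ) : Multiset ℕ := (Encodable.decode x.unpair.2).getD 0

theorem kidsOfCode_code (t : BinaryTree Unit) : kidsOfCode (code t) = kids t := by
  simp [kidsOfCode, code]

open Classical in
theorem card_not_isTerminal (m : ℕ) :
    ((rootedTrees Δ m).filter fun M => ¬ IsTerminal M).card =
      ((branchPairs Δ (m + 1)).filter fun p => CodeLT p.1 p.2).card := by
  refine (Finset.card_nbij (fun p => p.2 ::ₘ kidsOfCode p.1) ?_ ?_ ?_).symm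
  · rintro ⟨x, y⟩ h
    simp only [Finset.mem_coe, Finset.mem_filter, mem_branchPairs] at h ⊢
    obtain ⟨⟨⟨a, rfl, ha⟩, ⟨b, rfl, hb⟩, h1⟩, h2⟩ := h
    rw [wt_code, wt_code] at h1
    rw [kidsOfCode_code, ← kids_node, mem_rootedTrees, degBdd_node, BinaryTree.numNodes]
    exact ⟨⟨⟨ha, hb⟩, by omega⟩, fun h => h _ ⟨a, b, rfl, rfl, h2⟩⟩
  · rintro ⟨x, y⟩ h ⟨x', y'⟩ h' heq
    simp only [Finset.mem_coe, Finset.mem_filter, mem_branchPairs] at h h' heq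
    obtain ⟨⟨⟨a, rfl, ha⟩, ⟨b, rfl, hb⟩, -⟩, h2⟩ := h
    obtain ⟨⟨⟨a', rfl, ha'⟩, ⟨b', rfl, hb'⟩, -⟩, h2'⟩ := h'
    rw [kidsOfCode_code, kidsOfCode_code] at heq
    obtain ⟨h3, h4⟩ := code_eq_of_codeLT heq h2 h2'
    rw [h3, h4]
  · intro M hM
    simp only [Finset.mem_coe, Finset.mem_filter, IsTerminal, not_forall, not_not] at hM
    obtain ⟨h1, M', a, b, rfl, -, h2⟩ := hM
    rw [mem_rootedTrees, degBdd_node, BinaryTree.numNodes] at h1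
    refine ⟨(code a, code b), ?_, by simp only [kidsOfCode_code, kids_node]⟩
    simp only [Finset.mem_coe, Finset.mem_filter, mem_branchPairs, wt_code, isBranch_code]
    exact ⟨⟨h1.1.1, h1.1.2, by omega⟩, h2⟩

theorem isTreeCount (Δ : ℕ) : IsTreeCount Δ (fun n => (branches Δ n).card) (tTotal Δ)
    (fun k m => (forests Δ k m).card) where
  h_zero := card_forests_zero
  newton := card_forests_newton
  a_zero := card_branches_zero
  a_succ := card_branches_succ
  a_le := card_branches_le
  dissimilarity n := by
    classical
    rw [← card_branchPairs]
    cases n with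
    | zero =>
      have : (branchPairs Δ 0).card = 0 := by simp [card_branchPairs, card_branches_zero]
      simp [this, tTotal_zero, card_branches_zero, shiftSeq]
    | succ m =>
      have h := Finset.card_filter_add_card_filter_not (s := rootedTrees Δ m) IsTerminal
      rw [← tTotal_succ, card_not_isTerminal, rootedTrees, card_biUnion_forests] at h
      rw [card_branchPairs_eq, shiftSeq, ← h]
      ring

end Dissimilarity

/-- Otter. There are constants `τ > 0` and `0 < x₀ ≤ 1/2` with
`t_n · n^{5/2} · x₀ⁿ → τ`, i.e. `t_n ∼ τ · x₀^{−n} / n^{5/2}`. -/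
theorem tree_count_asymptotics (Δ : ℕ) (hΔ : 3 ≤ Δ) :
    ∃ τ x₀ : ℝ, 0 < τ ∧ 0 < x₀ ∧ x₀ ≤ 1 / 2 ∧
      Tendsto (fun n : ℕ => (tTotal Δ n : ℝ) * (n : ℝ) ^ ((5 : ℝ) / 2) * x₀ ^ n)
        atTop (𝓝 τ) := by
  exact (isTreeCount Δ).tendsto hΔ

end TreePaper
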